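/- arXiv:2306.05794 — 8 statements merged into one kernel-verified Lean document; each statement's English description precedes it below -/
import Mathlib

section
/- Let K be a field, M a finitely generated Lie algebra over K, and i ≥ 1 a natural number. If γ_{i+1}(M) is finitely generated as a Lie algebra, then for every i-central extension 0 → R → L → M → 0 of Lie algebras over K, the ideal γ_{i+1}(L) is finitely generated as a Lie algebra. -/
/-- A Lie algebra `A` over `K` is finitely generated (as a Lie algebra):
there is a finite subset generating `A` as a Lie algebra. -/
def LieAlgebraFG (K A : Type*) [Field K] [LieRing A] [LieAlgebra K A] : Prop :=
  ∃ S : Finset A, LieSubalgebra.lieSpan K A ↑S = ⊤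

/-- A Lie algebra `A` over `K` is finitely presented: it is isomorphic to the
quotient of the free Lie algebra on a finite set by an ideal generated (as an
ideal) by finitely many elements. -/
def LieAlgebraFP (K A : Type*) [Field K] [LieRing A] [LieAlgebra K A] : Prop :=
  ∃ (n : ℕ) (S : Finset (FreeLieAlgebra K (Fin n))),
    Nonempty ((FreeLieAlgebra K (Fin n) ⧸
      (LieSubmodule.lieSpan K (FreeLieAlgebra K (Fin n))
        (↑S : Set (FreeLieAlgebra K (Fin n))) :
          LieIdeal K (FreeLieAlgebra K (Fin n)))) ≃ₗ⁅K⁆ A)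

/-- `gammaRel K L R j = γ_{j+1}(R, L)` : `γ_1(R, L) = R` and
`γ_{j+1}(R, L) = ⁅γ_j(R, L), L⁆`. -/
def gammaRel (K L : Type*) [Field K] [LieRing L] [LieAlgebra K L]
    (R : LieIdeal K L) : ℕ → LieIdeal K L
  | 0 => R
  | j + 1 => ⁅gammaRel K L R j, (⊤ : LieIdeal K L)⁆

/-- `gammaLCS K M i = γ_{i+1}(M)` : the lower central series `γ_1(M) = M`,
`γ_{i+1}(M) = ⁅γ_i(M), M⁆`. -/
def gammaLCS (K M : Type*) [Field K] [LieRing M] [LieAlgebra K M] (i : ℕ) : LieIdeal K M :=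
  gammaRel K M ⊤ i

universe u v


section Helpers

variable {K L : Type*} [Field K] [LieRing L] [LieAlgebra K L]

theorem lie_mem_gammaRel_succ {R : LieIdeal K L} {j : ℕ} {a : L} (ha : a ∈ gammaRel K L R j)
    (l : L) : ⁅a, l⁆ ∈ gammaRel K L R (j + 1) :=
  LieSubmodule.lie_mem_lie ha (LieSubmodule.mem_top l)

theorem gammaRel_succ_le {R : LieIdeal K L} {j : ℕ} {P : Submodule K L}
    (h : ∀ a ∈ gammaRel K L R j, ∀ l, ⁅a, l⁆ ∈ P) {a : L}
    (ha : a ∈ gammaRel K L R (j + 1)) : a ∈ P := by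
  have ha' : a ∈ (⁅gammaRel K L R j, (⊤ : LieIdeal K L)⁆ : LieIdeal K L).toSubmodule := ha
  rw [LieSubmodule.lieIdeal_oper_eq_linear_span'] at ha'
  refine Submodule.span_le.2 ?_ ha'
  rintro _ ⟨b, hb, l, -, rfl⟩
  exact h b hb l

theorem lie_mem_gammaRel_add {R : LieIdeal K L} (j : ℕ) :
    ∀ {k : ℕ} {a r : L}, a ∈ gammaRel K L ⊤ j → r ∈ gammaRel K L R k →
      ⁅a, r⁆ ∈ gammaRel K L R (k + j + 1) := by
  induction j with
  | zero =>
    intro k a r _ hr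
    rw [← lie_skew]
    exact neg_mem (lie_mem_gammaRel_succ hr a)
  | succ j ih =>
    intro k a r ha hr
    refine gammaRel_succ_le (P := (gammaRel K L R (k + (j + 1) + 1)).toSubmodule.comap
      ((LieModule.toEnd K L L : L →ₗ[K] Module.End K L).flip r)) ?_ ha
    intro b hb l
    change ⁅⁅b, l⁆, r⁆ ∈ gammaRel K L R (k + (j + 1) + 1)
    have h₁ : ⁅⁅b, r⁆, l⁆ ∈ gammaRel K L R (k + (j + 1) + 1) :=
      lie_mem_gammaRel_succ (ih hb hr) l
    have h₂ : ⁅b, ⁅r, l⁆⁆ ∈ gammaRel K L R (k + (j + 1) + 1) := by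
      have := ih hb (lie_mem_gammaRel_succ hr l)
      rwa [show k + 1 + j + 1 = k + (j + 1) + 1 by omega] at this
    have e : ⁅⁅b, l⁆, r⁆ = ⁅⁅b, r⁆, l⁆ - ⁅b, ⁅r, l⁆⁆ := by
      rw [leibniz_lie b r l, lie_lie b l r, ← lie_skew r ⁅b, l⁆, lie_lie b l r]
      abel
    rw [e]
    exact sub_mem h₁ h₂

theorem lie_mem_of_mem_lieSpan {X : Set L} {B : Submodule K L}
    (hB : ∀ b ∈ B, ∀ x ∈ X, ⁅b, x⁆ ∈ B) {a h : L} (ha : ∀ x ∈ X, ⁅a, x⁆ ∈ B)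
    (hh : h ∈ LieSubalgebra.lieSpan K L X) : ⁅a, h⁆ ∈ B := by
  suffices h : (∀ b ∈ B, ⁅b, h⁆ ∈ B) ∧ ⁅a, h⁆ ∈ B from h.2
  induction hh using LieSubalgebra.lieSpan_induction with
  | mem x hx => exact ⟨fun b hb => hB b hb x hx, ha x hx⟩
  | zero => simp
  | add u v _ _ hu hv =>
    simp only [lie_add]
    exact ⟨fun b hb => add_mem (hu.1 b hb) (hv.1 b hb), add_mem hu.2 hv.2⟩
  | smul t u _ hu =>
    simp only [lie_smul]
    exact ⟨fun b hb => B.smul_mem t (hu.1 b hb), B.smul_mem t hu.2⟩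
  | lie u v _ _ hu hv =>
    have e : ∀ b : L, ⁅b, ⁅u, v⁆⁆ = ⁅⁅b, u⁆, v⁆ - ⁅⁅b, v⁆, u⁆ := by
      intro b
      rw [leibniz_lie b u v, ← lie_skew u ⁅b, v⁆, sub_eq_add_neg]
    simp only [e]
    exact ⟨fun b hb => sub_mem (hv.1 _ (hu.1 b hb)) (hu.1 _ (hv.1 b hb)),
      sub_mem (hv.1 _ hu.2) (hu.1 _ hv.2)⟩

/-- If `L` is generated by a finite set `X` modulo an ideal `R`, then modulo `γ_{j+1}(R, L)` the
ideal `γ_{j+1}(L)` is generated, as a subspace stable under bracketing with `X`, by a finite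
set. -/
theorem exists_finite_gammaLCS_le {X : Set L} (hX : X.Finite) {R : LieIdeal K L}
    (hL : ∀ l : L, ∃ h ∈ LieSubalgebra.lieSpan K L X, ∃ r ∈ R, l = h + r) (j : ℕ) :
    ∃ T : Set L, T.Finite ∧ (∀ t ∈ T, t ∈ gammaLCS K L j) ∧
      ∀ B : Submodule K L, T ⊆ B → (∀ b ∈ B, ∀ x ∈ X, ⁅b, x⁆ ∈ B) →
        ∀ g ∈ gammaLCS K L j, ∃ b ∈ B, ∃ r ∈ gammaRel K L R j, g = b + r := by
  induction j with
  | zero =>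
    refine ⟨X, hX, fun t _ => LieSubmodule.mem_top t, fun B hXB hB g hg => ?_⟩
    clear hg
    obtain ⟨h, hh, r, hr, rfl⟩ := hL g
    refine ⟨h, ?_, r, hr, rfl⟩
    clear hL
    induction hh using LieSubalgebra.lieSpan_induction with
    | mem x hx => exact hXB hx
    | zero => exact zero_mem B
    | add u v _ _ hu hv => exact add_mem hu hv
    | smul t u _ hu => exact B.smul_mem t hu
    | lie u v _ hv hu _ => exact lie_mem_of_mem_lieSpan hB (hB u hu) hv
  | succ j ih =>
    obtain ⟨T, hT, hTG, ih⟩ := ih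
    refine ⟨Set.image2 (fun t x => ⁅t, x⁆) T X, hT.image2 _ hX, ?_, ?_⟩
    · rintro _ ⟨t, ht, x, -, rfl⟩
      exact lie_mem_gammaRel_succ (hTG t ht) x
    · intro B hTB hB g hg
      let A : Submodule K L :=
        { carrier := {a | ∀ x ∈ X, ⁅a, x⁆ ∈ B}
          add_mem' := fun {a b} ha hb x hx => by
            rw [add_lie]; exact add_mem (ha x hx) (hb x hx)
          zero_mem' := fun x _ => by simp
          smul_mem' := fun c a ha x hx => by
            rw [smul_lie]; exact B.smul_mem c (ha x hx) }
      have hA := ih A (fun t ht x hx => hTB ⟨t, ht, x, hx, rfl⟩)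
        (fun a ha x hx y hy => hB _ (ha x hx) y hy)
      have key : g ∈ B ⊔ (gammaRel K L R (j + 1)).toSubmodule := by
        refine gammaRel_succ_le (fun g hg l => ?_) hg
        obtain ⟨h, hh, r, hr, rfl⟩ := hL l
        obtain ⟨a, ha, s, hs, hgas⟩ := hA g hg
        have e : ⁅g, h + r⁆ = ⁅a, h⁆ + (⁅s, h⁆ + ⁅g, r⁆) := by
          rw [lie_add, ← add_assoc, ← add_lie, ← hgas]
        rw [e]
        refine Submodule.add_mem_sup (lie_mem_of_mem_lieSpan hB ha hh)
          (add_mem (lie_mem_gammaRel_succ hs h) ?_)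
        have := lie_mem_gammaRel_add j (k := 0) hg hr
        rwa [Nat.zero_add] at this
      obtain ⟨b, hb, r, hr, rfl⟩ := Submodule.mem_sup.1 key
      exact ⟨b, hb, r, hr, rfl⟩

theorem exists_finite_superset_lie_mem {X : Set L} (hX : X.Finite) {R J : LieIdeal K L} {i : ℕ}
    (hR : gammaRel K L R i = ⊥) (n : ℕ) :
    ∀ {k : ℕ}, n + k = i → ∀ D : Set L, D.Finite → (∀ d ∈ D, d ∈ J) →
      (∀ d ∈ D, d ∈ gammaRel K L R k) →
      ∃ E : Set L, D ⊆ E ∧ E.Finite ∧ (∀ e ∈ E, e ∈ J) ∧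
        ∀ e ∈ E, ∀ x ∈ X, ⁅e, x⁆ ∈ E := by
  induction n with
  | zero =>
    rintro k hk D hD hDJ hDR
    obtain rfl : k = i := by omega
    refine ⟨{0}, fun d hd => ?_, Set.finite_singleton 0, ?_, ?_⟩
    · simpa [hR] using hDR d hd
    · rintro _ rfl
      exact zero_mem J
    · rintro _ rfl x _
      simp
  | succ n ih =>
    intro k hk D hD hDJ hDR
    obtain ⟨E, hDE, hE, hEJ, hEX⟩ := ih (k := k + 1) (by omega)
      (Set.image2 (fun d x => ⁅d, x⁆) D X) (hD.image2 _ hX)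
      (by rintro _ ⟨d, hd, x, -, rfl⟩; exact lie_mem_left K L J d x (hDJ d hd))
      (by rintro _ ⟨d, hd, x, -, rfl⟩; exact lie_mem_gammaRel_succ (hDR d hd) x)
    refine ⟨D ∪ E, Set.subset_union_left, hD.union hE, ?_, ?_⟩
    · rintro e (he | he)
      exacts [hDJ e he, hEJ e he]
    · rintro e (he | he) x hx
      exacts [Or.inr (hDE ⟨e, he, x, hx, rfl⟩), Or.inr (hEX e he x hx)]

theorem LieAlgebraFG.exists_finite_of_lieIdeal {J : LieIdeal K L} (h : LieAlgebraFG K J) :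
    ∃ S : Set L, S.Finite ∧ (∀ s ∈ S, s ∈ J) ∧ ∀ g ∈ J, g ∈ LieSubalgebra.lieSpan K L S := by
  obtain ⟨S, hS⟩ := h
  refine ⟨J.incl '' S, S.finite_toSet.image _, ?_, fun g hg => ?_⟩
  · rintro _ ⟨s, -, rfl⟩
    exact s.2
  · rw [← LieSubalgebra.map_lieSpan, hS]
    exact ⟨⟨g, hg⟩, trivial, rfl⟩

theorem LieAlgebraFG.of_finite_of_lieIdeal {J : LieIdeal K L} {S : Set L} (hS : S.Finite)
    (hSJ : ∀ s ∈ S, s ∈ J) (h : ∀ g ∈ J, g ∈ LieSubalgebra.lieSpan K L S) :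
    LieAlgebraFG K J := by
  have hfin : (J.incl ⁻¹' S).Finite := hS.preimage Subtype.val_injective.injOn
  refine ⟨hfin.toFinset, ?_⟩
  rw [hfin.coe_toFinset, eq_top_iff]
  rintro ⟨g, hg⟩ -
  have hS' : J.incl '' (J.incl ⁻¹' S) = S :=
    Set.image_preimage_eq_of_subset fun s hs => ⟨⟨s, hSJ s hs⟩, rfl⟩
  have hg' := h g hg
  rw [← hS', ← LieSubalgebra.map_lieSpan] at hg'
  obtain ⟨g', hg', e⟩ := hg'
  obtain rfl : g' = ⟨g, hg⟩ := Subtype.ext e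
  exact hg'

theorem map_gammaLCS {M : Type*} [LieRing M] [LieAlgebra K M] {π : L →ₗ⁅K⁆ M}
    (hπ : Function.Surjective π) (j : ℕ) :
    (gammaLCS K L j).map π = gammaLCS K M j := by
  have htop : (⊤ : LieIdeal K L).map π = ⊤ := by
    rw [eq_top_iff]
    intro m _
    obtain ⟨l, rfl⟩ := hπ m
    exact LieIdeal.mem_map (LieSubmodule.mem_top l)
  induction j with
  | zero => exact htop
  | succ j ih =>
    change LieIdeal.map π ⁅gammaLCS K L j, (⊤ : LieIdeal K L)⁆ = ⁅gammaLCS K M j, ⊤⁆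
    rw [LieIdeal.map_bracket_eq π hπ, ih, htop]

/-- A finite set `S` in the image of `J` lifts to a finite subset `Y` of `J`, and the preimage of
the subalgebra generated by `S` is the subalgebra generated by `Y` up to the kernel. -/
theorem exists_finite_lift {M : Type*} [LieRing M] [LieAlgebra K M] {π : L →ₗ⁅K⁆ M}
    {J : Set L} {S : Set M} (hS : S.Finite) (hSJ : S ⊆ π '' J) :
    ∃ Y : Set L, Y.Finite ∧ Y ⊆ J ∧
      ∀ g, π g ∈ LieSubalgebra.lieSpan K M S →
        ∃ h ∈ LieSubalgebra.lieSpan K L Y, ∃ r ∈ π.ker, g = h + r := by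
  obtain ⟨Y, hYJ, hY⟩ := Set.exists_subset_bijOn (J ∩ π ⁻¹' S) π
  rw [Set.image_inter_preimage, Set.inter_eq_right.2 hSJ] at hY
  refine ⟨Y, hY.finite_iff_finite.2 hS, fun y hy => (hYJ hy).1, fun g hg => ?_⟩
  rw [← hY.image_eq, ← LieSubalgebra.map_lieSpan] at hg
  obtain ⟨h, hh, e⟩ := hg
  refine ⟨h, hh, g - h, ?_, by abel⟩
  rw [LieHom.mem_ker, map_sub, sub_eq_zero]
  exact e.symm

end Helpers

theorem baer_fg_of_gamma_fg (K : Type*) [Field K] (M : Type u) [LieRing M] [LieAlgebra K M]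
    (hM : LieAlgebraFG K M) (i : ℕ) (hi : 1 ≤ i)
    (hγ : LieAlgebraFG K ↑(gammaLCS K M i)) :
    ∀ (L : Type v) [LieRing L] [LieAlgebra K L] (π : L →ₗ⁅K⁆ M),
      Function.Surjective π → gammaRel K L π.ker i = ⊥ →
        LieAlgebraFG K ↑(gammaLCS K L i) := by
  intro L _ _ π hπ hR
  obtain ⟨S, hS⟩ := hM
  obtain ⟨X, hX, -, hLX⟩ := exists_finite_lift (K := K) (π := π) (J := Set.univ) S.finite_toSet
    (by rw [Set.image_univ_of_surjective hπ]; exact Set.subset_univ _)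
  replace hLX := fun l => hLX l (hS ▸ LieSubalgebra.mem_top (π l))
  obtain ⟨T, hT, hTG, hTB⟩ := exists_finite_gammaLCS_le hX hLX i
  obtain ⟨S', hS', hSG, hgen⟩ := hγ.exists_finite_of_lieIdeal
  obtain ⟨Y, hY, hYG, hGY⟩ := exists_finite_lift (K := K) (π := π)
    (J := (gammaLCS K L i : Set L)) hS' (fun s hs => by
      have hs := hSG s hs
      rw [← map_gammaLCS hπ] at hs
      obtain ⟨x, hx⟩ := LieIdeal.mem_map_of_surjective hπ hs
      exact ⟨x, x.2, hx⟩)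
  have hdec : ∀ g ∈ gammaLCS K L i, ∃ r, r ∈ π.ker ∧ r ∈ gammaLCS K L i ∧
      g - r ∈ LieSubalgebra.lieSpan K L Y := by
    intro g hg
    obtain ⟨h, hh, r, hr, rfl⟩ := hGY g
      (hgen _ (by rw [← map_gammaLCS hπ]; exact LieIdeal.mem_map hg))
    have hhG : h ∈ gammaLCS K L i := by
      have : LieSubalgebra.lieSpan K L Y ≤ (gammaLCS K L i).toLieSubalgebra :=
        LieSubalgebra.lieSpan_le.2 hYG
      exact this hh
    refine ⟨r, hr, ?_, by simpa using hh⟩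
    simpa using sub_mem hg hhG
  choose! ρ hρR hρG hρ using hdec
  have hCG : ∀ c ∈ T ∪ Set.image2 (fun y x => ⁅y, x⁆) Y X, c ∈ gammaLCS K L i := by
    rintro c (hc | ⟨y, hy, x, -, rfl⟩)
    exacts [hTG c hc, lie_mem_left K L _ y x (hYG hy)]
  obtain ⟨E, hDE, hE, hEG, hEX⟩ := exists_finite_superset_lie_mem hX (J := gammaLCS K L i) hR i
    (k := 0) rfl (ρ '' (T ∪ Set.image2 (fun y x => ⁅y, x⁆) Y X))
    ((hT.union (hY.image2 _ hX)).image _)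
    (by rintro _ ⟨c, hc, rfl⟩; exact hρG c (hCG c hc))
    (by rintro _ ⟨c, hc, rfl⟩; exact hρR c (hCG c hc))
  have hC : ∀ c ∈ T ∪ Set.image2 (fun y x => ⁅y, x⁆) Y X,
      c ∈ LieSubalgebra.lieSpan K L (Y ∪ E) := by
    intro c hc
    rw [← sub_add_cancel c (ρ c)]
    exact add_mem (LieSubalgebra.lieSpan_mono Set.subset_union_left (hρ c (hCG c hc)))
      (LieSubalgebra.subset_lieSpan (Or.inr (hDE ⟨c, hc, rfl⟩)))
  refine LieAlgebraFG.of_finite_of_lieIdeal (hY.union hE) ?_ fun g hg => ?_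
  · rintro s (hs | hs)
    exacts [hYG hs, hEG s hs]
  obtain ⟨b, hb, r, hr, rfl⟩ := hTB (LieSubalgebra.lieSpan K L (Y ∪ E)).toSubmodule
    (fun t ht => hC t (Or.inl ht)) (fun b hb x hx => by
      have hb : b ∈ LieSubalgebra.lieSpan K L (Y ∪ E) := hb
      change ⁅b, x⁆ ∈ LieSubalgebra.lieSpan K L (Y ∪ E)
      induction hb using LieSubalgebra.lieSpan_induction with
      | mem y hy =>
        rcases hy with hy | hy
        · exact hC _ (Or.inr ⟨y, hy, x, hx, rfl⟩)
        · exact LieSubalgebra.subset_lieSpan (Or.inr (hEX y hy x hx))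
      | zero => simp
      | add u v _ _ hu hv => rw [add_lie]; exact add_mem (hu ‹_›) (hv ‹_›)
      | smul t u _ hu => rw [smul_lie]; exact LieSubalgebra.smul_mem _ t (hu ‹_›)
      | lie u v hu' hv' hu hv =>
        rw [lie_lie]
        exact sub_mem (LieSubalgebra.lie_mem _ hu' (hv hv'))
          (LieSubalgebra.lie_mem _ hv' (hu hu'))) g hg
  rw [hR, LieSubmodule.mem_bot] at hr
  rw [hr, add_zero]
  exact hb
end

section
/- Let K be a field and M a finitely generated Lie algebra over K whose commutator ideal [M, M] is finitely generated as a Lie algebra. Then for every central extension 0 → R → L → M → 0 of Lie algebras over K (i.e. a surjective Lie algebra homomorphism L → M whose kernel R is contained in the centre of L), the commutator ideal [L, L] is finitely generated as a Lie algebra. -/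
theorem LieAlgebraFG.exists_finite_of_ideal {K A : Type*} [Field K] [LieRing A] [LieAlgebra K A]
    {I : LieIdeal K A} (h : LieAlgebraFG K I) :
    ∃ T : Set A, T.Finite ∧ T ⊆ I ∧ ∀ x ∈ I, x ∈ LieSubalgebra.lieSpan K A T := by
  obtain ⟨S, hS⟩ := h
  refine ⟨Subtype.val '' (S : Set I), S.finite_toSet.image _, ?_, fun x hx => ?_⟩
  · rintro _ ⟨y, -, rfl⟩
    exact y.2
  · have key : LieSubalgebra.lieSpan K I (S : Set I) ≤
        (LieSubalgebra.lieSpan K A (Subtype.val '' (S : Set I))).comap I.incl := by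
      rw [LieSubalgebra.lieSpan_le]
      exact fun y hy => LieSubalgebra.subset_lieSpan ⟨y, hy, rfl⟩
    rw [hS] at key
    exact key (LieSubalgebra.mem_top (⟨x, hx⟩ : I))

theorem lieAlgebraFG_ideal_of_finite {K A : Type*} [Field K] [LieRing A] [LieAlgebra K A]
    {I : LieIdeal K A} {T : Set A} (hfin : T.Finite) (hTI : T ⊆ I)
    (hT : ∀ x ∈ I, x ∈ LieSubalgebra.lieSpan K A T) : LieAlgebraFG K I := by
  have hfin' : (Subtype.val ⁻¹' T : Set I).Finite :=
    hfin.preimage Subtype.val_injective.injOn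
  refine ⟨hfin'.toFinset, ?_⟩
  rw [Set.Finite.coe_toFinset, eq_top_iff]
  rintro x -
  have key : LieSubalgebra.lieSpan K A T ≤
      (LieSubalgebra.lieSpan K I (Subtype.val ⁻¹' T)).map I.incl := by
    rw [LieSubalgebra.lieSpan_le]
    intro y hy
    exact (LieSubalgebra.mem_map _ _ _).2
      ⟨⟨y, hTI hy⟩, LieSubalgebra.subset_lieSpan hy, rfl⟩
  obtain ⟨y, hy, hyx⟩ := (LieSubalgebra.mem_map _ _ _).1 (key (hT x x.2))
  rwa [← Subtype.ext (show (y : A) = x from hyx)]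

/-- If `U` is contained in the image of `T`, then every element of the subalgebra generated by `U`
has a preimage in the subalgebra generated by `T`. -/
theorem exists_mem_lieSpan_of_map {K L M : Type*} [Field K] [LieRing L] [LieAlgebra K L]
    [LieRing M] [LieAlgebra K M] (π : L →ₗ⁅K⁆ M) {T : Set L} {U : Set M} (hU : U ⊆ π '' T)
    {m : M} (hm : m ∈ LieSubalgebra.lieSpan K M U) :
    ∃ p ∈ LieSubalgebra.lieSpan K L T, π p = m := by
  have key : LieSubalgebra.lieSpan K M U ≤ (LieSubalgebra.lieSpan K L T).map π := by
    rw [LieSubalgebra.lieSpan_le]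
    intro y hy
    obtain ⟨t, ht, rfl⟩ := hU hy
    exact (LieSubalgebra.mem_map _ _ _).2 ⟨t, LieSubalgebra.subset_lieSpan ht, rfl⟩
  exact (LieSubalgebra.mem_map _ _ _).1 (key hm)

theorem lie_eq_of_map_eq {K L M : Type*} [Field K] [LieRing L] [LieAlgebra K L]
    [LieRing M] [LieAlgebra K M] {π : L →ₗ⁅K⁆ M} (hπ : π.ker ≤ LieAlgebra.center K L)
    {a b : L} (h : π a = π b) (x : L) : ⁅x, a⁆ = ⁅x, b⁆ := by
  have hc : a - b ∈ LieAlgebra.center K L := hπ (by simp [LieHom.mem_ker, h])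
  have := (LieModule.mem_maxTrivSubmodule K L L (a - b)).1 hc x
  rwa [lie_sub, sub_eq_zero] at this

/-- Induction on the elements of `L`, generated by `X` together with the kernel of `π`. -/
theorem induction_of_lieSpan_image_eq_top {K L M : Type*} [Field K] [LieRing L] [LieAlgebra K L]
    [LieRing M] [LieAlgebra K M] (π : L →ₗ⁅K⁆ M) {X : Set L} {U : Set M} (hX : U ⊆ π '' X)
    (hU : LieSubalgebra.lieSpan K M U = ⊤) {p : L → Prop}
    (mem : ∀ x ∈ X, p x) (ker : ∀ x ∈ π.ker, p x)
    (add : ∀ x y, p x → p y → p (x + y)) (smul : ∀ (a : K) x, p x → p (a • x))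
    (lie : ∀ x y, p x → p y → p ⁅x, y⁆) (x : L) : p x := by
  obtain ⟨y, hy, hyx⟩ := exists_mem_lieSpan_of_map π hX (hU ▸ LieSubalgebra.mem_top (π x))
  have hpy : p y := by
    clear hyx
    induction hy using LieSubalgebra.lieSpan_induction with
    | mem y hy => exact mem y hy
    | zero => exact ker 0 π.ker.zero_mem
    | add y z _ _ hy hz => exact add y z hy hz
    | smul a y _ hy => exact smul a y hy
    | lie y z _ _ hy hz => exact lie y z hy hz
  rw [← add_sub_cancel y x]
  exact add _ _ hpy (ker _ (by simp [LieHom.mem_ker, hyx]))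

universe u v

theorem schur_fg (K : Type*) [Field K] (M : Type u) [LieRing M] [LieAlgebra K M]
    (hM : LieAlgebraFG K M)
    (hcomm : LieAlgebraFG K ↑(⁅(⊤ : LieIdeal K M), (⊤ : LieIdeal K M)⁆ : LieIdeal K M)) :
    ∀ (L : Type v) [LieRing L] [LieAlgebra K L] (π : L →ₗ⁅K⁆ M),
      Function.Surjective π → π.ker ≤ LieAlgebra.center K L →
        LieAlgebraFG K ↑(⁅(⊤ : LieIdeal K L), (⊤ : LieIdeal K L)⁆ : LieIdeal K L) := by
  intro L _ _ π hsurj hπ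
  set H : LieIdeal K L := ⁅(⊤ : LieIdeal K L), (⊤ : LieIdeal K L)⁆ with hH
  have lie_mem_H (a b : L) : ⁅a, b⁆ ∈ H :=
    LieSubmodule.lie_mem_lie (LieSubmodule.mem_top a) (LieSubmodule.mem_top b)
  have lie_ker (a : L) {r : L} (hr : r ∈ π.ker) : ⁅a, r⁆ = 0 := by
    rw [lie_eq_of_map_eq hπ (show π r = π 0 by simpa using hr), lie_zero]
  have ker_lie {r : L} (hr : r ∈ π.ker) (a : L) : ⁅r, a⁆ = 0 := by
    rw [← lie_skew, lie_ker a hr, neg_zero]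
  have hmap : LieIdeal.map π H = ⁅(⊤ : LieIdeal K M), (⊤ : LieIdeal K M)⁆ := by
    rw [hH, LieIdeal.map_bracket_eq π hsurj, ← LieHom.idealRange_eq_map,
      LieHom.idealRange_eq_top_of_surjective π hsurj]
  obtain ⟨S, hS⟩ := hM
  obtain ⟨U, hUfin, hUsub, hU⟩ := hcomm.exists_finite_of_ideal
  choose g hg using hsurj
  have hlift : ∀ m ∈ U, ∃ x ∈ H, π x = m := by
    intro m hm
    have hm' : m ∈ LieIdeal.map π H := hmap ▸ hUsub hm
    obtain ⟨x, hx⟩ := LieIdeal.mem_map_of_surjective (fun m => ⟨g m, hg m⟩) hm'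
    exact ⟨x, x.2, hx⟩
  choose! c hcH hc using hlift
  let C : Set L := c '' U
  let X : Set L := g '' (S : Set M)
  have hCfin : C.Finite := hUfin.image c
  have hUC : U ⊆ π '' C := fun m hm => ⟨c m, ⟨m, hm, rfl⟩, hc m hm⟩
  have hXfin : X.Finite := S.finite_toSet.image g
  have hSX : (S : Set M) ⊆ π '' X := fun m hm => ⟨g m, ⟨m, hm, rfl⟩, hg m⟩
  let T : Set L := C ∪ (Set.image2 (fun a b => ⁅a, b⁆) X X ∪ Set.image2 (fun a b => ⁅a, b⁆) X C)
  have hTfin : T.Finite := hCfin.union ((hXfin.image2 _ hXfin).union (hXfin.image2 _ hCfin))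
  have hTH : T ⊆ H := by
    rintro _ (⟨m, hm, rfl⟩ | ⟨a, -, b, -, rfl⟩ | ⟨a, -, b, -, rfl⟩)
    exacts [hcH m hm, lie_mem_H a b, lie_mem_H a b]
  refine lieAlgebraFG_ideal_of_finite hTfin hTH ?_
  set Q := LieSubalgebra.lieSpan K L T
  have hCQ : LieSubalgebra.lieSpan K L C ≤ Q := LieSubalgebra.lieSpan_mono Set.subset_union_left
  have lie_X_H : ∀ x ∈ X, ∀ h ∈ H, ⁅x, h⁆ ∈ Q := by
    intro x hx h hh
    have hπh : π h ∈ LieSubalgebra.lieSpan K M U :=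
      hU _ (hmap ▸ LieIdeal.mem_map hh)
    obtain ⟨p, hp, hph⟩ := exists_mem_lieSpan_of_map π hUC hπh
    rw [← lie_eq_of_map_eq hπ hph]
    clear hph
    induction hp using LieSubalgebra.lieSpan_induction with
    | mem y hy => exact LieSubalgebra.subset_lieSpan (Or.inr (Or.inr ⟨x, hx, y, hy, rfl⟩))
    | zero => simp
    | add y z _ _ hy hz => exact lie_add x y z ▸ add_mem hy hz
    | smul a y _ hy => exact lie_smul a x y ▸ Q.smul_mem a hy
    | lie y z hy hz hy' hz' =>
      rw [leibniz_lie]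
      exact add_mem (Q.lie_mem hy' (hCQ hz)) (Q.lie_mem (hCQ hy) hz')
  have lie_L_H (x : L) : ∀ h ∈ H, ⁅x, h⁆ ∈ Q := by
    induction x using induction_of_lieSpan_image_eq_top π hSX hS with
    | mem x hx => exact lie_X_H x hx
    | ker r hr => exact fun h _ => by simp [ker_lie hr h]
    | add x y hx hy => exact fun h hh => add_lie x y h ▸ add_mem (hx h hh) (hy h hh)
    | smul a x hx => exact fun h hh => smul_lie a x h ▸ Q.smul_mem a (hx h hh)
    | lie x y hx hy =>
      exact fun h _ => lie_lie x y h ▸ sub_mem (hx _ (lie_mem_H y h)) (hy _ (lie_mem_H x h))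
  have lie_X_L (x : L) (hx : x ∈ X) (y : L) : ⁅x, y⁆ ∈ Q := by
    induction y using induction_of_lieSpan_image_eq_top π hSX hS with
    | mem y hy => exact LieSubalgebra.subset_lieSpan (Or.inr (Or.inl ⟨x, hx, y, hy, rfl⟩))
    | ker r hr => simp [lie_ker x hr]
    | add y z hy hz => exact lie_add x y z ▸ add_mem hy hz
    | smul a y hy => exact lie_smul a x y ▸ Q.smul_mem a hy
    | lie y z _ _ => exact lie_L_H x _ (lie_mem_H y z)
  have lie_L_L (x y : L) : ⁅x, y⁆ ∈ Q := by
    induction x using induction_of_lieSpan_image_eq_top π hSX hS with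
    | mem x hx => exact lie_X_L x hx y
    | ker r hr => simp [ker_lie hr y]
    | add x z hx hz => exact add_lie x z y ▸ add_mem hx hz
    | smul a x hx => exact smul_lie a x y ▸ Q.smul_mem a hx
    | lie x z _ _ => exact lie_skew ⁅x, z⁆ y ▸ neg_mem (lie_L_H y _ (lie_mem_H x z))
  have hHQ : H.toSubmodule ≤ Q.toSubmodule := by
    rw [hH, LieSubmodule.lieIdeal_oper_eq_linear_span', Submodule.span_le]
    rintro _ ⟨x, -, y, -, rfl⟩
    exact lie_L_L x y
  exact fun x hx => hHQ hx
end

section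
/- Let K be a field and M a finitely presented Lie algebra over K whose commutator ideal [M, M] is finitely presented as a Lie algebra. Then for every central extension 0 → R → L → M → 0 of Lie algebras over K (i.e. a surjective Lie algebra homomorphism L → M whose kernel R is contained in the centre of L), the commutator ideal [L, L] is finitely presented as a Lie algebra. -/
universe u v

namespace FreeLieAlgebra

variable {K X : Type*} [Field K]

theorem eq_top_of_of_mem (H : LieSubalgebra K (FreeLieAlgebra K X)) (h : ∀ x, of K x ∈ H) :
    H = ⊤ := by
  rw [eq_top_iff]
  intro g _
  let f : FreeLieAlgebra K X →ₗ⁅K⁆ H := lift K fun x => ⟨of K x, h x⟩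
  have hf : H.incl.comp f = LieHom.id := by
    ext x
    simp [f]
  have := LieHom.congr_fun hf g
  have h2 : ((f g : H) : FreeLieAlgebra K X) = g := by simpa using this
  exact h2 ▸ (f g).2

theorem lie_mem_of_of_lie_mem (Q : LieIdeal K (FreeLieAlgebra K X)) (y : FreeLieAlgebra K X)
    (h : ∀ x : X, ⁅of K x, y⁆ ∈ Q) (g : FreeLieAlgebra K X) : ⁅g, y⁆ ∈ Q := by
  let H : LieSubalgebra K (FreeLieAlgebra K X) :=
    { carrier := {g | ⁅g, y⁆ ∈ Q}
      add_mem' := fun {a b} ha hb => by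
        simpa only [Set.mem_ofPred_eq, add_lie] using add_mem ha hb
      zero_mem' := by simp
      smul_mem' := fun c a ha => by
        rw [Set.mem_ofPred_eq, smul_lie]
        exact Q.smul_mem c ha
      lie_mem' := fun {a b} ha hb => by
        simp only [Set.mem_ofPred_eq, lie_lie]
        exact sub_mem (lie_mem_right K _ Q _ _ hb) (lie_mem_right K _ Q _ _ ha) }
  have : g ∈ H := by
    rw [eq_top_of_of_mem H h]
    trivial
  exact this

theorem sub_mem_of_of_sub_mem {L : Type*} [LieRing L] [LieAlgebra K L] (I : LieIdeal K L)
    (f₁ f₂ : FreeLieAlgebra K X →ₗ⁅K⁆ L) (h : ∀ x, f₁ (of K x) - f₂ (of K x) ∈ I)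
    (g : FreeLieAlgebra K X) : f₁ g - f₂ g ∈ I := by
  let H : LieSubalgebra K (FreeLieAlgebra K X) :=
    { carrier := {g | f₁ g - f₂ g ∈ I}
      add_mem' := fun {a b} ha hb => by
        simpa only [Set.mem_ofPred_eq, map_add, add_sub_add_comm] using add_mem ha hb
      zero_mem' := by simp
      smul_mem' := fun c a ha => by
        rw [Set.mem_ofPred_eq, map_smul, map_smul, ← smul_sub]
        exact I.smul_mem c ha
      lie_mem' := fun {a b} ha hb => by
        have : f₁ ⁅a, b⁆ - f₂ ⁅a, b⁆ = ⁅f₁ a - f₂ a, f₁ b⁆ + ⁅f₂ a, f₁ b - f₂ b⁆ := by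
          simp
        rw [Set.mem_ofPred_eq, this]
        exact add_mem (lie_mem_left K _ I _ _ ha) (lie_mem_right K _ I _ _ hb) }
  have : g ∈ H := by
    rw [eq_top_of_of_mem H h]
    trivial
  exact this

end FreeLieAlgebra

section FinitePresentation

variable {K A B : Type*} [Field K] [LieRing A] [LieAlgebra K A] [LieRing B] [LieAlgebra K B]

theorem lieAlgebraFP_iff :
    LieAlgebraFP K A ↔ ∃ (n : ℕ) (S : Set (FreeLieAlgebra K (Fin n)))
      (φ : FreeLieAlgebra K (Fin n) →ₗ⁅K⁆ A), S.Finite ∧ Function.Surjective φ ∧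
        φ.ker = LieSubmodule.lieSpan K (FreeLieAlgebra K (Fin n)) S := by
  constructor
  · rintro ⟨n, S, ⟨e⟩⟩
    let I : LieIdeal K (FreeLieAlgebra K (Fin n)) := LieSubmodule.lieSpan K _ S
    let q : FreeLieAlgebra K (Fin n) →ₗ⁅K⁆ FreeLieAlgebra K (Fin n) ⧸ I :=
      { (LieSubmodule.Quotient.mk' I : FreeLieAlgebra K (Fin n) →ₗ[K] _) with
        map_lie' := fun {x y} => LieSubmodule.Quotient.mk_bracket I x y }
    refine ⟨n, S, e.toLieHom.comp q, S.finite_toSet, ?_, ?_⟩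
    · exact e.surjective.comp (LieSubmodule.Quotient.surjective_mk' I)
    · ext g
      rw [LieHom.mem_ker]
      change e (LieSubmodule.Quotient.mk g : _ ⧸ I) = 0 ↔ g ∈ I
      rw [← LieSubmodule.Quotient.mk_eq_zero' (N := I)]
      exact map_eq_zero_iff e e.injective
  · rintro ⟨n, S, φ, hS, hφ, hker⟩
    refine ⟨n, hS.toFinset, ?_⟩
    rw [hS.coe_toFinset, ← hker]
    have htop : φ.range = ⊤ := (LieHom.range_eq_top φ).2 hφ
    have e : (φ.range : LieSubalgebra K A) ≃ₗ⁅K⁆ A :=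
      (LieEquiv.ofEq _ _ (congrArg _ htop)).trans LieSubalgebra.topEquiv
    exact ⟨φ.quotKerEquivRange.trans e⟩

open FreeLieAlgebra in
/-- A central extension of a finitely presented Lie algebra with finite-dimensional kernel is
finitely presented. -/
theorem LieAlgebraFP.of_central_extension (hB : LieAlgebraFP K B) (p : A →ₗ⁅K⁆ B)
    (hp : Function.Surjective p) (hcent : p.ker ≤ LieAlgebra.center K A)
    [FiniteDimensional K p.ker] : LieAlgebraFP K A := by
  obtain ⟨n, S, φ, hS, hφ, hker⟩ := lieAlgebraFP_iff.1 hB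
  let m := Module.finrank K p.ker
  let k : Module.Basis (Fin m) K p.ker := Module.finBasis K p.ker
  choose a ha using fun i : Fin n => hp (φ (of K i))
  let ψ : FreeLieAlgebra K (Fin (n + m)) →ₗ⁅K⁆ A :=
    lift K (Fin.append a fun j => (k j : A))
  let ι : FreeLieAlgebra K (Fin n) →ₗ⁅K⁆ FreeLieAlgebra K (Fin (n + m)) :=
    lift K fun i => of K (Fin.castAdd m i)
  let r : FreeLieAlgebra K (Fin (n + m)) →ₗ⁅K⁆ FreeLieAlgebra K (Fin n) :=
    lift K (Fin.append (of K) fun _ => 0)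
  let y : p.ker →ₗ[K] FreeLieAlgebra K (Fin (n + m)) := k.constr K fun j => of K (Fin.natAdd n j)
  have hyk (j) : y (k j) = of K (Fin.natAdd n j) := k.constr_basis K _ j
  have hψy (c) : ψ (y c) = c := by
    have : (ψ : _ →ₗ[K] A) ∘ₗ y = p.ker.toSubmodule.subtype := k.ext fun j => by
      simp [hyk, ψ]
      rfl
    exact LinearMap.congr_fun this c
  have hpψ (g) : p (ψ g) = φ (r g) := by
    have : p.comp ψ = φ.comp r := by
      ext x
      induction x using Fin.addCases with
      | left i => simp [ψ, r, ha]
      | right j => simpa [ψ, r] using (LieHom.mem_ker).1 (k j).2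
    exact LieHom.congr_fun this g
  have hrι (f) : r (ι f) = f := by
    have : r.comp ι = LieHom.id := by ext x; simp [r, ι]
    exact LieHom.congr_fun this f
  have hφS (s) (hs : s ∈ S) : φ s = 0 :=
    LieHom.mem_ker.1 (hker ▸ LieSubmodule.subset_lieSpan hs)
  have hψS (s) (hs : s ∈ S) : ψ (ι s) ∈ p.ker := by
    rw [LieHom.mem_ker, hpψ, hrι, hφS s hs]
  let T : Set (FreeLieAlgebra K (Fin (n + m))) :=
    Set.range (fun s : S => ι s - y ⟨ψ (ι s), hψS s s.2⟩) ∪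
      Set.range fun z : Fin (n + m) × Fin m => ⁅of K z.1, y (k z.2)⁆
  let Q : LieIdeal K (FreeLieAlgebra K (Fin (n + m))) := LieSubmodule.lieSpan K _ T
  have hTQ : T ⊆ Q := LieSubmodule.subset_lieSpan
  have := hS.to_subtype
  refine lieAlgebraFP_iff.2 ⟨n + m, T, ψ, (Set.finite_range _).union (Set.finite_range _), ?_, ?_⟩
  · intro b
    obtain ⟨f, hf⟩ := hφ (p b)
    have hb : b - ψ (ι f) ∈ p.ker := by
      rw [LieHom.mem_ker, map_sub, hpψ, hrι, hf, sub_self]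
    exact ⟨ι f + y ⟨_, hb⟩, by rw [map_add, hψy, add_sub_cancel]⟩
  have hQψ : Q ≤ ψ.ker := by
    rw [LieSubmodule.lieSpan_le]
    rintro _ (⟨s, rfl⟩ | ⟨z, rfl⟩)
    · simp [hψy]
    · have := (LieModule.mem_maxTrivSubmodule K A A _).1 (hcent (k z.2).2) (ψ (of K z.1))
      rw [SetLike.mem_coe, LieHom.mem_ker, LieHom.map_lie, hψy, this]
  have hQy (g : FreeLieAlgebra K (Fin (n + m))) (c) : ⁅g, y c⁆ ∈ Q := by
    rw [← k.sum_repr c, map_sum, lie_sum]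
    refine sum_mem fun j _ => ?_
    rw [map_smul, lie_smul]
    exact Q.smul_mem _ (lie_mem_of_of_lie_mem Q _ (fun x => hTQ (.inr ⟨(x, j), rfl⟩)) g)
  let I : LieIdeal K (FreeLieAlgebra K (Fin (n + m))) :=
    { toSubmodule := Q.toSubmodule ⊔ LinearMap.range y
      lie_mem := fun {x g} hg => by
        obtain ⟨q, hq, _, ⟨c, rfl⟩, rfl⟩ := Submodule.mem_sup.1 hg
        rw [lie_add]
        exact Submodule.mem_sup_left (add_mem (lie_mem_right K _ Q _ _ hq) (hQy x c)) }
  have hQI : Q ≤ I := fun g hg => Submodule.mem_sup_left hg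
  have hyI (c) : y c ∈ I := Submodule.mem_sup_right ⟨c, rfl⟩
  have hιI : φ.ker ≤ I.comap ι := by
    rw [hker, LieSubmodule.lieSpan_le]
    intro s hs
    rw [SetLike.mem_coe, LieIdeal.mem_comap]
    have := add_mem (hQI (hTQ (.inl ⟨⟨s, hs⟩, rfl⟩))) (hyI ⟨ψ (ι s), hψS s hs⟩)
    simpa using this
  have hrI (g) : ι (r g) - g ∈ I :=
    sub_mem_of_of_sub_mem I (ι.comp r) LieHom.id (fun x => by
      induction x using Fin.addCases with
      | left i => simp [ι, r]
      | right j => simpa [ι, r, hyk] using hyI (k j)) g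
  refine le_antisymm (fun g hg => ?_) hQψ
  have hgI : g ∈ I := by
    have h1 : ι (r g) ∈ I := LieIdeal.mem_comap.1 <| hιI <| by
      rw [LieHom.mem_ker, ← hpψ, LieHom.mem_ker.1 hg, map_zero]
    simpa using sub_mem h1 (hrI g)
  obtain ⟨q, hq, _, ⟨c, rfl⟩, rfl⟩ := Submodule.mem_sup.1 hgI
  have hc : (c : A) = 0 := by
    rw [← hψy, ← LieHom.mem_ker.1 hg, map_add, LieHom.mem_ker.1 (hQψ hq), zero_add]
  rw [show c = 0 from Subtype.ext hc, map_zero, add_zero]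
  exact hq

/-- The part of the kernel of a central extension of a finitely presented Lie algebra lying in the
commutator ideal is finite-dimensional. -/
theorem LieAlgebraFP.finiteDimensional_ker_inf_commutator (hB : LieAlgebraFP K B) (p : A →ₗ⁅K⁆ B)
    (hp : Function.Surjective p) (hcent : p.ker ≤ LieAlgebra.center K A) :
    FiniteDimensional K ↥(p.ker ⊓ ⁅(⊤ : LieIdeal K A), (⊤ : LieIdeal K A)⁆).toSubmodule := by
  obtain ⟨n, S, φ, hS, hφ, hker⟩ := lieAlgebraFP_iff.1 hB
  choose a ha using fun i : Fin n => hp (φ (FreeLieAlgebra.of K i))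
  let ψ : FreeLieAlgebra K (Fin n) →ₗ⁅K⁆ A := FreeLieAlgebra.lift K a
  have hpψ (g) : p (ψ g) = φ g := by
    have : p.comp ψ = φ := by ext x; simp [ψ, ha]
    exact LieHom.congr_fun this g
  have hlie (x c : A) (hc : c ∈ p.ker) : ⁅x, c⁆ = 0 :=
    (LieModule.mem_maxTrivSubmodule K A A _).1 (hcent hc) x
  let V : Submodule K A := Submodule.span K (ψ '' S)
  have : FiniteDimensional K V := FiniteDimensional.span_of_finite K (hS.image ψ)
  have hVker : V ≤ p.ker.toSubmodule := by
    rw [Submodule.span_le]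
    rintro _ ⟨s, hs, rfl⟩
    change ψ s ∈ p.ker
    rw [LieHom.mem_ker, hpψ, ← LieHom.mem_ker, hker]
    exact LieSubmodule.subset_lieSpan hs
  let J : LieIdeal K (FreeLieAlgebra K (Fin n)) :=
    { toSubmodule := V.comap (ψ : _ →ₗ[K] A)
      lie_mem := fun {x g} hg => by
        change ψ ⁅x, g⁆ ∈ V
        rw [LieHom.map_lie, hlie (ψ x) (ψ g) (hVker hg)]
        exact V.zero_mem }
  have hJ : φ.ker ≤ J := by
    rw [hker, LieSubmodule.lieSpan_le]
    exact fun s hs => Submodule.subset_span ⟨s, hs, rfl⟩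
  have hdecomp (x : A) : ∃ g, x - ψ g ∈ p.ker := by
    obtain ⟨g, hg⟩ := hφ (p x)
    exact ⟨g, by rw [LieHom.mem_ker, map_sub, hpψ, hg, sub_self]⟩
  have hrange : (⁅(⊤ : LieIdeal K A), (⊤ : LieIdeal K A)⁆ : LieIdeal K A).toSubmodule ≤
      LinearMap.range (ψ : FreeLieAlgebra K (Fin n) →ₗ[K] A) := by
    rw [LieSubmodule.lieIdeal_oper_eq_linear_span', Submodule.span_le]
    rintro _ ⟨x, -, z, -, rfl⟩
    obtain ⟨g, hg⟩ := hdecomp x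
    obtain ⟨h, hh⟩ := hdecomp z
    refine ⟨⁅g, h⁆, ?_⟩
    have h1 : ⁅x, z⁆ = ⁅x, ψ h⁆ := by rw [← sub_eq_zero, ← lie_sub, hlie _ _ hh]
    have h2 : ⁅x, ψ h⁆ = ⁅ψ g, ψ h⁆ := by
      rw [← sub_eq_zero, ← sub_lie, ← lie_skew, hlie _ _ hg, neg_zero]
    rw [h1, h2]
    exact LieHom.map_lie ψ g h
  refine Submodule.finiteDimensional_of_le (S₂ := V) fun x hx => ?_
  obtain ⟨hxk, hxc⟩ := hx
  obtain ⟨g, rfl⟩ := hrange hxc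
  refine hJ ?_
  rw [LieHom.mem_ker, ← hpψ]
  exact LieHom.mem_ker.1 hxk

end FinitePresentation

theorem schur_fp (K : Type*) [Field K] (M : Type u) [LieRing M] [LieAlgebra K M]
    (hM : LieAlgebraFP K M)
    (hcomm : LieAlgebraFP K ↑(⁅(⊤ : LieIdeal K M), (⊤ : LieIdeal K M)⁆ : LieIdeal K M)) :
    ∀ (L : Type v) [LieRing L] [LieAlgebra K L] (π : L →ₗ⁅K⁆ M),
      Function.Surjective π → π.ker ≤ LieAlgebra.center K L →
        LieAlgebraFP K ↑(⁅(⊤ : LieIdeal K L), (⊤ : LieIdeal K L)⁆ : LieIdeal K L) := by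
  intro L _ _ π hπ hcent
  have hmap : (⁅(⊤ : LieIdeal K L), (⊤ : LieIdeal K L)⁆ : LieIdeal K L).toSubmodule.map
      (π : L →ₗ[K] M) = (⁅(⊤ : LieIdeal K M), (⊤ : LieIdeal K M)⁆ : LieIdeal K M).toSubmodule := by
    rw [LieSubmodule.lieIdeal_oper_eq_linear_span', LieSubmodule.lieIdeal_oper_eq_linear_span',
      Submodule.map_span]
    congr 1
    ext z
    constructor
    · rintro ⟨_, ⟨x, -, y, -, rfl⟩, rfl⟩
      exact ⟨π x, trivial, π y, trivial, (LieHom.map_lie π x y).symm⟩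
    · rintro ⟨x, -, y, -, rfl⟩
      obtain ⟨x, rfl⟩ := hπ x
      obtain ⟨y, rfl⟩ := hπ y
      exact ⟨⁅x, y⁆, ⟨x, trivial, y, trivial, rfl⟩, LieHom.map_lie π x y⟩
  let p : (⁅(⊤ : LieIdeal K L), (⊤ : LieIdeal K L)⁆ : LieIdeal K L) →ₗ⁅K⁆
      (⁅(⊤ : LieIdeal K M), (⊤ : LieIdeal K M)⁆ : LieIdeal K M) :=
    { toFun := fun x => ⟨π x, hmap.le ⟨x, x.2, rfl⟩⟩
      map_add' := fun x y => Subtype.ext (map_add π (x : L) y)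
      map_smul' := fun c x => Subtype.ext (map_smul π c (x : L))
      map_lie' := fun {x y} => Subtype.ext (LieHom.map_lie π (x : L) y) }
  have hpker {x} (hx : x ∈ p.ker) : (x : L) ∈ π.ker :=
    LieHom.mem_ker.2 (congrArg Subtype.val (LieHom.mem_ker.1 hx))
  have hpsurj : Function.Surjective p := by
    rintro ⟨z, hz⟩
    obtain ⟨x, hx, rfl⟩ := hmap.ge hz
    exact ⟨⟨x, hx⟩, rfl⟩
  have hpcent : p.ker ≤ LieAlgebra.center K _ := fun x hx =>
    (LieModule.mem_maxTrivSubmodule K _ _ _).2 fun y => Subtype.ext <|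
      (LieModule.mem_maxTrivSubmodule K L L _).1 (hcent (hpker hx)) y
  have := hM.finiteDimensional_ker_inf_commutator π hπ hcent
  let j : p.ker.toSubmodule →ₗ[K]
      (π.ker ⊓ ⁅(⊤ : LieIdeal K L), (⊤ : LieIdeal K L)⁆ : LieIdeal K L).toSubmodule :=
    { toFun := fun x => ⟨x.1.1, hpker x.2, x.1.2⟩
      map_add' := fun _ _ => rfl
      map_smul' := fun _ _ => rfl }
  have : FiniteDimensional K p.ker := FiniteDimensional.of_injective j fun x y h =>
    Subtype.ext (Subtype.ext (congrArg Subtype.val h : (j x : L) = j y))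
  exact hcomm.of_central_extension p hpsurj hpcent
end

section
/- Let K be a field and let 0 → A → B → C → 0 be a short exact sequence of Lie algebras over K (a surjective Lie algebra homomorphism B → C with kernel A) in which the ideal A is finite-dimensional as a K-vector space. Then B is finitely presented if and only if C is finitely presented. -/
universe u v

/-- The quotient map by an ideal of a Lie algebra, as a homomorphism of Lie algebras. -/
def LieIdeal.quotientHom {R L : Type*} [CommRing R] [LieRing L] [LieAlgebra R L]
    (I : LieIdeal R L) : L →ₗ⁅R⁆ L ⧸ I :=
  { (LieSubmodule.Quotient.mk' I : L →ₗ[R] L ⧸ I) with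
    map_lie' := fun {x y} => LieSubmodule.Quotient.mk_bracket I x y }

theorem LieIdeal.quotientHom_eq_zero {R L : Type*} [CommRing R] [LieRing L] [LieAlgebra R L]
    {I : LieIdeal R L} {x : L} : I.quotientHom x = 0 ↔ x ∈ I :=
  LieSubmodule.Quotient.mk_eq_zero I

theorem LieIdeal.quotientHom_surjective {R L : Type*} [CommRing R] [LieRing L] [LieAlgebra R L]
    (I : LieIdeal R L) : Function.Surjective I.quotientHom :=
  LieSubmodule.Quotient.surjective_mk' I

theorem lieAlgebraFP_iff_exists_surjective {K A : Type*} [Field K] [LieRing A] [LieAlgebra K A] :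
    LieAlgebraFP K A ↔ ∃ (n : ℕ) (S : Finset (FreeLieAlgebra K (Fin n)))
      (f : FreeLieAlgebra K (Fin n) →ₗ⁅K⁆ A), Function.Surjective f ∧
        f.ker = LieSubmodule.lieSpan K (FreeLieAlgebra K (Fin n))
          (↑S : Set (FreeLieAlgebra K (Fin n))) := by
  constructor
  · rintro ⟨n, S, ⟨e⟩⟩
    refine ⟨n, S, e.toLieHom.comp (LieIdeal.quotientHom _),
      e.surjective.comp (LieIdeal.quotientHom_surjective _), ?_⟩
    ext x
    rw [LieHom.mem_ker, ← LieIdeal.quotientHom_eq_zero]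
    exact map_eq_zero_iff e.toLinearEquiv e.toLinearEquiv.injective
  · rintro ⟨n, S, f, hf, hker⟩
    refine ⟨n, S, ⟨?_⟩⟩
    rw [← hker]
    exact f.quotKerEquivRange.trans
      ((LieEquiv.ofEq _ _ (by rw [(LieHom.range_eq_top f).2 hf])).trans LieSubalgebra.topEquiv)

theorem FreeLieAlgebra.mem_lieSubalgebra {R X : Type*} [CommRing R]
    (H : LieSubalgebra R (FreeLieAlgebra R X)) (h : ∀ x, FreeLieAlgebra.of R x ∈ H)
    (z : FreeLieAlgebra R X) : z ∈ H := by
  have key : H.incl.comp (FreeLieAlgebra.lift R fun x => (⟨FreeLieAlgebra.of R x, h x⟩ : H)) =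
      LieHom.id := by
    ext x
    simp
  rw [← LieHom.id_apply (R := R) z, ← key]
  exact Subtype.property _

/-- The elements of a Lie algebra whose adjoint action preserves a given subspace. -/
def LieSubalgebra.stabilizer {R L : Type*} [CommRing R] [LieRing L] [LieAlgebra R L]
    (W : Submodule R L) : LieSubalgebra R L where
  carrier := {z | ∀ w ∈ W, ⁅z, w⁆ ∈ W}
  zero_mem' w _ := by simp
  add_mem' hx hy w hw := by
    rw [add_lie]
    exact W.add_mem (hx w hw) (hy w hw)
  smul_mem' t x hx w hw := by
    rw [smul_lie]
    exact W.smul_mem t (hx w hw)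
  lie_mem' hx hy w hw := by
    rw [lie_lie]
    exact W.sub_mem (hx _ (hy w hw)) (hy _ (hx w hw))

/-- Finite presentability passes to quotients by finite-dimensional ideals. -/
theorem LieAlgebraFP.of_surjective {K B C : Type*} [Field K] [LieRing B] [LieAlgebra K B]
    [LieRing C] [LieAlgebra K C] (π : B →ₗ⁅K⁆ C) (hsurj : Function.Surjective π)
    (hA : FiniteDimensional K ↑π.ker) (hB : LieAlgebraFP K B) : LieAlgebraFP K C := by
  classical
  obtain ⟨n, S, f, hf, hker⟩ := lieAlgebraFP_iff_exists_surjective.1 hB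
  let b := Module.finBasis K π.ker
  choose y hy using fun j => hf (b j : B)
  refine lieAlgebraFP_iff_exists_surjective.2
    ⟨n, S ∪ Finset.univ.image y, π.comp f, hsurj.comp hf, le_antisymm (fun x hx => ?_) ?_⟩
  · have hfx : f x ∈ π.ker := hx
    set v := ∑ j, b.repr ⟨f x, hfx⟩ j • y j with hv
    have hfv : f v = f x := by
      have h := congrArg (Subtype.val : π.ker → B) (b.sum_repr ⟨f x, hfx⟩)
      simpa [-Module.Basis.sum_repr, hv, map_sum, hy] using h
    have h1 : x - v ∈ f.ker := by simp [hfv]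
    rw [hker] at h1
    have h2 : v ∈ LieSubmodule.lieSpan K (FreeLieAlgebra K (Fin n))
        (↑(S ∪ Finset.univ.image y) : Set (FreeLieAlgebra K (Fin n))) :=
      sum_mem fun j _ => SMulMemClass.smul_mem _ (LieSubmodule.subset_lieSpan (by simp))
    rw [← sub_add_cancel x v]
    exact add_mem (LieSubmodule.lieSpan_mono (by simp) h1) h2
  · rw [LieSubmodule.lieSpan_le]
    intro s hs
    simp only [Finset.coe_union, Finset.coe_image, Finset.coe_univ, Set.image_univ,
      Set.mem_union, Set.mem_range] at hs
    obtain hs | ⟨j, rfl⟩ := hs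
    · have h : s ∈ f.ker := hker ▸ LieSubmodule.subset_lieSpan hs
      rw [LieHom.mem_ker] at h
      simp [h]
    · have h : π (b j) = 0 := (b j).2
      simp [hy, h]

/-- Finite presentability passes to extensions by finite-dimensional ideals. -/
theorem LieAlgebraFP.of_quotient {K B C : Type*} [Field K] [LieRing B] [LieAlgebra K B]
    [LieRing C] [LieAlgebra K C] (π : B →ₗ⁅K⁆ C) (hsurj : Function.Surjective π)
    (hA : FiniteDimensional K ↑π.ker) (hC : LieAlgebraFP K C) : LieAlgebraFP K B := by
  classical
  obtain ⟨n, S, g, hg, hker⟩ := lieAlgebraFP_iff_exists_surjective.1 hC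
  let b := Module.finBasis K π.ker
  set m := Module.finrank K π.ker
  choose β hβ using fun i => hsurj (g (FreeLieAlgebra.of K i))
  let φ : FreeLieAlgebra K (Fin (n + m)) →ₗ⁅K⁆ B :=
    FreeLieAlgebra.lift K (Fin.append β fun j => (b j : B))
  let ι : FreeLieAlgebra K (Fin n) →ₗ⁅K⁆ FreeLieAlgebra K (Fin (n + m)) :=
    FreeLieAlgebra.lift K fun i => FreeLieAlgebra.of K (Fin.castAdd m i)
  let ρ : FreeLieAlgebra K (Fin (n + m)) →ₗ⁅K⁆ FreeLieAlgebra K (Fin n) :=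
    FreeLieAlgebra.lift K (Fin.append (FreeLieAlgebra.of K) fun _ => 0)
  let y : Fin m → FreeLieAlgebra K (Fin (n + m)) := fun j => FreeLieAlgebra.of K (Fin.natAdd n j)
  have hbπ (j : Fin m) : π (b j) = 0 := (b j).2
  have hφy (j : Fin m) : φ (y j) = b j := by simp [φ, y]
  have hπφι (w) : π (φ (ι w)) = g w := by
    have : (π.comp φ).comp ι = g := by
      ext i
      simp [φ, ι, hβ]
    exact LieHom.congr_fun this w
  have hgρ (z) : g (ρ z) = π (φ z) := by
    have : g.comp ρ = π.comp φ := by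
      ext i
      induction i using Fin.addCases <;> simp [φ, ρ, hβ, hbπ]
    exact LieHom.congr_fun this z
  -- The linear section of `φ` over the kernel of `π`.
  let V : Submodule K (FreeLieAlgebra K (Fin (n + m))) := Submodule.span K (Set.range y)
  have hsec (a : B) : ∃ v ∈ V, π a = 0 → φ v = a := by
    by_cases ha : π a = 0
    · refine ⟨∑ j, b.repr ⟨a, ha⟩ j • y j,
        sum_mem fun j _ => V.smul_mem _ (Submodule.subset_span ⟨j, rfl⟩), fun _ => ?_⟩
      have h := congrArg (Subtype.val : π.ker → B) (b.sum_repr ⟨a, ha⟩)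
      simpa [-Module.Basis.sum_repr, map_sum, hφy] using h
    · exact ⟨0, V.zero_mem, fun h => absurd h ha⟩
  choose σ hσV hσ using hsec
  have hVφ (v : FreeLieAlgebra K (Fin (n + m))) (hv : v ∈ V) (h0 : φ v = 0) : v = 0 := by
    obtain ⟨c, rfl⟩ := (Submodule.mem_span_range_iff_exists_fun K).1 hv
    have h : ∑ j, c j • b j = 0 := by
      apply Subtype.ext
      simpa [map_sum, hφy] using h0
    have hc := Fintype.linearIndependent_iff.1 b.linearIndependent c h
    simp [hc]
  let r : FreeLieAlgebra K (Fin (n + m)) → FreeLieAlgebra K (Fin (n + m)) := fun z => z - σ (φ z)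
  have hr (z : FreeLieAlgebra K (Fin (n + m))) (hz : π (φ z) = 0) : φ (r z) = 0 := by
    simp [r, hσ _ hz]
  let T : Finset (FreeLieAlgebra K (Fin (n + m))) := S.image (fun s => r (ι s)) ∪
    Finset.univ.image (fun p : Fin (n + m) × Fin m => r ⁅FreeLieAlgebra.of K p.1, y p.2⁆)
  let I : LieIdeal K (FreeLieAlgebra K (Fin (n + m))) :=
    LieSubmodule.lieSpan K _ (T : Set (FreeLieAlgebra K (Fin (n + m))))
  have hIφ : I ≤ φ.ker := by
    refine LieSubmodule.lieSpan_le.2 fun t ht => ?_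
    obtain ht | ht := Finset.mem_union.1 ht
    · obtain ⟨s, hs, rfl⟩ := Finset.mem_image.1 ht
      have h : s ∈ g.ker := hker ▸ LieSubmodule.subset_lieSpan hs
      exact hr _ ((hπφι s).trans h)
    · obtain ⟨p, -, rfl⟩ := Finset.mem_image.1 ht
      exact hr _ (by simp [hφy, hbπ])
  let W : Submodule K (FreeLieAlgebra K (Fin (n + m))) := V ⊔ I.toSubmodule
  have hWr (z : FreeLieAlgebra K (Fin (n + m))) (hz : r z ∈ I) : z ∈ W := by
    rw [← add_sub_cancel (σ (φ z)) z]
    exact Submodule.add_mem_sup (hσV _) hz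
  have hstab (z : FreeLieAlgebra K (Fin (n + m))) : z ∈ LieSubalgebra.stabilizer W := by
    refine FreeLieAlgebra.mem_lieSubalgebra _ (fun i w hw => ?_) z
    obtain ⟨v, hv, u, hu, rfl⟩ := Submodule.mem_sup.1 hw
    rw [lie_add]
    refine W.add_mem ?_ (Submodule.mem_sup_right (I.lie_mem hu))
    induction hv using Submodule.span_induction with
    | mem v hv =>
      obtain ⟨j, rfl⟩ := hv
      refine hWr _ (LieSubmodule.subset_lieSpan ?_)
      exact Finset.mem_union_right _ (Finset.mem_image.2 ⟨(i, j), Finset.mem_univ _, rfl⟩)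
    | zero => simp
    | add v v' hv hv' h h' =>
      rw [lie_add]
      exact W.add_mem (h (Submodule.add_mem_sup hv hu)) (h' (Submodule.add_mem_sup hv' hu))
    | smul t v hv h =>
      rw [lie_smul]
      exact W.smul_mem t (h (Submodule.add_mem_sup hv hu))
  let J : LieIdeal K (FreeLieAlgebra K (Fin (n + m))) :=
    { W with lie_mem := fun {x w} hw => hstab x w hw }
  have hιρ (z : FreeLieAlgebra K (Fin (n + m))) : z - ι (ρ z) ∈ J := by
    have : J.quotientHom = (J.quotientHom.comp ι).comp ρ := by
      ext i
      induction i using Fin.addCases with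
      | left i => simp [ρ, ι]
      | right j =>
        have hj : y j ∈ J := Submodule.mem_sup_left (Submodule.subset_span ⟨j, rfl⟩)
        simpa [ρ, y] using LieIdeal.quotientHom_eq_zero.2 hj
    rw [← LieIdeal.quotientHom_eq_zero, map_sub, sub_eq_zero]
    exact LieHom.congr_fun this z
  have hιker : g.ker ≤ J.comap ι := by
    rw [hker, LieSubmodule.lieSpan_le]
    intro s hs
    exact hWr _ (LieSubmodule.subset_lieSpan
      (Finset.mem_union_left _ (Finset.mem_image_of_mem _ hs)))
  refine lieAlgebraFP_iff_exists_surjective.2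
    ⟨n + m, T, φ, fun a => ?_, le_antisymm (fun z hz => ?_) hIφ⟩
  · obtain ⟨w, hw⟩ := hg (π a)
    refine ⟨ι w + σ (a - φ (ι w)), ?_⟩
    rw [map_add, hσ _ (by simp [hπφι, hw]), add_sub_cancel]
  · have hφz : φ z = 0 := hz
    have hρz : ρ z ∈ g.ker := by simp [hgρ, hφz]
    have hzJ : z ∈ J := by
      rw [← sub_add_cancel z (ι (ρ z))]
      exact add_mem (hιρ z) (hιker hρz)
    obtain ⟨v, hv, u, hu, rfl⟩ := Submodule.mem_sup.1 hzJ
    have hφu : φ u = 0 := hIφ hu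
    rw [map_add, hφu, add_zero] at hφz
    rw [hVφ v hv hφz, zero_add]
    exact hu

theorem fp_iff_fp_of_findim_kernel (K : Type*) [Field K]
    (B : Type u) [LieRing B] [LieAlgebra K B]
    (C : Type v) [LieRing C] [LieAlgebra K C] (π : B →ₗ⁅K⁆ C)
    (hsurj : Function.Surjective π) (hA : FiniteDimensional K ↑π.ker) :
    LieAlgebraFP K B ↔ LieAlgebraFP K C :=
  ⟨LieAlgebraFP.of_surjective π hsurj hA, LieAlgebraFP.of_quotient π hsurj hA⟩
end

section
/- Let K be a field and M a finitely generated Lie algebra over K. Then for every natural number i ≥ 1, the quotient γ_i(M)/γ_{i+1}(M) is a finite-dimensional K-vector space. -/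
universe u v

section LowerCentralFactors

variable {K : Type*} {M : Type*} [Field K] [LieRing M] [LieAlgebra K M]

theorem lie_lie_top_top_le (I : LieIdeal K M) :
    ⁅I, ⁅(⊤ : LieIdeal K M), (⊤ : LieIdeal K M)⁆⁆ ≤ ⁅⁅I, (⊤ : LieIdeal K M)⁆, (⊤ : LieIdeal K M)⁆ := by
  rw [LieSubmodule.lie_le_iff]
  intro x hx y hy
  rw [← LieSubmodule.mem_toSubmodule, LieSubmodule.lieIdeal_oper_eq_linear_span'] at hy
  induction hy using Submodule.span_induction with
  | mem y hy =>
    obtain ⟨a, ha, b, hb, rfl⟩ := hy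
    rw [leibniz_lie, ← lie_skew a]
    exact add_mem (LieSubmodule.lie_mem_lie (LieSubmodule.lie_mem_lie hx ha) hb)
      (neg_mem (LieSubmodule.lie_mem_lie (LieSubmodule.lie_mem_lie hx hb) ha))
  | zero => simp
  | add y z _ _ hy hz => rw [lie_add]; exact add_mem hy hz
  | smul c y _ hy => rw [lie_smul]; exact Submodule.smul_mem (LieSubmodule.toSubmodule _) c hy

/-- A Lie algebra is spanned by a generating set modulo its derived ideal. -/
theorem top_le_span_sup_derived {S : Set M} (hS : LieSubalgebra.lieSpan K M S = ⊤) :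
    (⊤ : Submodule K M) ≤
      Submodule.span K S ⊔ ⁅(⊤ : LieIdeal K M), (⊤ : LieIdeal K M)⁆.toSubmodule := by
  intro x _
  have hx : x ∈ LieSubalgebra.lieSpan K M S := hS ▸ LieSubalgebra.mem_top x
  induction hx using LieSubalgebra.lieSpan_induction with
  | mem x hx => exact Submodule.mem_sup_left (Submodule.subset_span hx)
  | zero => exact zero_mem _
  | add x y _ _ hx hy => exact add_mem (hx trivial) (hy trivial)
  | smul c x _ hx => exact Submodule.smul_mem _ c (hx trivial)
  | lie x y _ _ _ _ =>
    exact Submodule.mem_sup_right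
      (LieSubmodule.lie_mem_lie (LieSubmodule.mem_top x) (LieSubmodule.mem_top y))

theorem lie_top_le_map₂_sup {I : LieIdeal K M} {V W : Submodule K M}
    (hV : I.toSubmodule ≤ V ⊔ ⁅I, (⊤ : LieIdeal K M)⁆.toSubmodule)
    (hW : (⊤ : Submodule K M) ≤ W ⊔ ⁅(⊤ : LieIdeal K M), (⊤ : LieIdeal K M)⁆.toSubmodule) :
    ⁅I, (⊤ : LieIdeal K M)⁆.toSubmodule ≤
      Submodule.map₂ (LieModule.toEnd K M M : M →ₗ[K] M →ₗ[K] M) V W ⊔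
        ⁅⁅I, (⊤ : LieIdeal K M)⁆, (⊤ : LieIdeal K M)⁆.toSubmodule := by
  rw [LieSubmodule.lieIdeal_oper_eq_linear_span', Submodule.span_le]
  rintro _ ⟨x, hx, y, -, rfl⟩
  obtain ⟨v, hv, x', hx', rfl⟩ := Submodule.mem_sup.mp (hV hx)
  obtain ⟨w, hw, y', hy', rfl⟩ := Submodule.mem_sup.mp (hW (Submodule.mem_top (x := y)))
  have hvI : v ∈ I := by
    simpa using sub_mem (H := I) hx (LieSubmodule.lie_le_left I ⊤ hx')
  rw [add_lie, lie_add, add_assoc]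
  refine Submodule.add_mem_sup (Submodule.apply_mem_map₂ _ hv hw) (add_mem ?_ ?_)
  · exact lie_lie_top_top_le I (LieSubmodule.lie_mem_lie hvI hy')
  · exact LieSubmodule.lie_mem_lie hx' (LieSubmodule.mem_top _)

theorem gammaLCS_succ (i : ℕ) :
    gammaLCS K M (i + 1) = ⁅gammaLCS K M i, (⊤ : LieIdeal K M)⁆ := rfl

theorem exists_fg_gammaLCS_le_sup (hM : LieAlgebraFG K M) (i : ℕ) :
    ∃ V : Submodule K M, V.FG ∧
      (gammaLCS K M i).toSubmodule ≤ V ⊔ (gammaLCS K M (i + 1)).toSubmodule := by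
  obtain ⟨S, hS⟩ := hM
  have hW := top_le_span_sup_derived hS
  induction i with
  | zero => exact ⟨_, ⟨S, rfl⟩, hW⟩
  | succ i ih =>
    obtain ⟨V, hVfg, hV⟩ := ih
    exact ⟨_, hVfg.map₂ _ ⟨S, rfl⟩, lie_top_le_map₂_sup hV hW⟩

end LowerCentralFactors

/-- If `N ≤ V ⊔ P` with `V` finite-dimensional, then `N / (N ⊓ P)` is finite-dimensional. -/
theorem Submodule.finiteDimensional_quotient_comap_subtype {K M : Type*} [Field K]
    [AddCommGroup M] [Module K M] {N P V : Submodule K M} (hV : V.FG) (h : N ≤ V ⊔ P) :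
    FiniteDimensional K (N ⧸ P.comap N.subtype) := by
  have : FiniteDimensional K (V.map P.mkQ) := Module.Finite.iff_fg.mpr (hV.map _)
  let f : N →ₗ[K] V.map P.mkQ := (P.mkQ ∘ₗ N.subtype).codRestrict _ fun x => by
    obtain ⟨v, hv, p, hp, hx⟩ := Submodule.mem_sup.mp (h x.2)
    refine ⟨v, hv, ?_⟩
    simp [← hx, (Submodule.Quotient.mk_eq_zero P).mpr hp]
  have hf : LinearMap.ker f = P.comap N.subtype := by
    rw [LinearMap.ker_codRestrict, LinearMap.ker_comp, Submodule.ker_mkQ]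
  rw [← hf]
  exact Module.Finite.equiv f.quotKerEquivRange.symm

theorem gamma_factor_findim (K : Type*) [Field K] (M : Type u) [LieRing M] [LieAlgebra K M]
    (hM : LieAlgebraFG K M) :
    ∀ i : ℕ, 1 ≤ i →
      FiniteDimensional K
        ((gammaLCS K M (i - 1)).toSubmodule ⧸
          Submodule.comap (gammaLCS K M (i - 1)).toSubmodule.subtype
            (gammaLCS K M i).toSubmodule) := by
  intro i hi
  obtain ⟨i, rfl⟩ := Nat.exists_eq_add_of_le' hi
  obtain ⟨V, hV, h⟩ := exists_fg_gammaLCS_le_sup hM i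
  exact Submodule.finiteDimensional_quotient_comap_subtype hV h
end

section
/- Let K be a field and M a finitely generated Lie algebra over K. Then for every natural number i ≥ 1, the quotient Lie algebra M/γ_i(M) is a finite-dimensional K-vector space. -/
universe u v

theorem lie_mem_map₂_sup_lie_top {K M : Type*} [Field K] [LieRing M] [LieAlgebra K M]
    {V : Submodule K M} {I : LieIdeal K M} (h : V ⊔ I.toSubmodule = ⊤) (x y : M) :
    ⁅x, y⁆ ∈ Submodule.map₂ (LieModule.toEnd K M M : M →ₗ[K] Module.End K M) V V ⊔
      (⁅I, (⊤ : LieIdeal K M)⁆ : LieIdeal K M).toSubmodule := by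
  obtain ⟨v, hv, a, ha, rfl⟩ := Submodule.mem_sup.mp (h ▸ Submodule.mem_top : x ∈ V ⊔ I.toSubmodule)
  obtain ⟨w, hw, b, hb, rfl⟩ := Submodule.mem_sup.mp (h ▸ Submodule.mem_top : y ∈ V ⊔ I.toSubmodule)
  have hab : ⁅a, w + b⁆ ∈ (⁅I, (⊤ : LieIdeal K M)⁆ : LieIdeal K M) :=
    LieSubmodule.lie_mem_lie ha (LieSubmodule.mem_top _)
  have hvb : ⁅v, b⁆ ∈ (⁅I, (⊤ : LieIdeal K M)⁆ : LieIdeal K M) := by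
    rw [← lie_skew]
    exact neg_mem (LieSubmodule.lie_mem_lie hb (LieSubmodule.mem_top _))
  rw [add_lie, lie_add v, add_assoc]
  exact Submodule.add_mem_sup
    (Submodule.apply_mem_map₂ (LieModule.toEnd K M M : M →ₗ[K] Module.End K M) hv hw)
    (add_mem hvb hab)

theorem exists_fg_sup_gammaLCS_eq_top {K M : Type*} [Field K] [LieRing M] [LieAlgebra K M]
    (hM : LieAlgebraFG K M) (n : ℕ) :
    ∃ V : Submodule K M, V.FG ∧ V ⊔ (gammaLCS K M n).toSubmodule = ⊤ := by
  induction n with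
  | zero => exact ⟨⊥, Submodule.fg_bot, by simp [gammaLCS, gammaRel]⟩
  | succ n ih =>
    obtain ⟨V, hV, hsup⟩ := ih
    obtain ⟨S, hS⟩ := hM
    refine ⟨Submodule.span K S ⊔
      Submodule.map₂ (LieModule.toEnd K M M : M →ₗ[K] Module.End K M) V V,
      (Submodule.fg_span S.finite_toSet).sup (hV.map₂ _ hV), ?_⟩
    rw [sup_assoc, eq_top_iff]
    intro x _
    have hx : x ∈ LieSubalgebra.lieSpan K M (S : Set M) := hS ▸ LieSubalgebra.mem_top x
    induction hx using LieSubalgebra.lieSpan_induction with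
    | mem x hx => exact Submodule.mem_sup_left (Submodule.subset_span hx)
    | zero => exact zero_mem _
    | add x y _ _ hx hy => exact add_mem (hx trivial) (hy trivial)
    | smul c x _ hx => exact Submodule.smul_mem _ c (hx trivial)
    | lie x y _ _ _ _ => exact Submodule.mem_sup_right (lie_mem_map₂_sup_lie_top hsup x y)

theorem quotient_by_gamma_findim (K : Type*) [Field K]
    (M : Type u) [LieRing M] [LieAlgebra K M] (hM : LieAlgebraFG K M) :
    ∀ i : ℕ, 1 ≤ i → FiniteDimensional K (M ⧸ gammaLCS K M (i - 1)) := by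
  intro i _
  obtain ⟨V, hV, hsup⟩ := exists_fg_sup_gammaLCS_eq_top hM (i - 1)
  have : Module.Finite K V := Module.Finite.iff_fg.mpr hV
  let π : M →ₗ[K] M ⧸ gammaLCS K M (i - 1) := (gammaLCS K M (i - 1)).toSubmodule.mkQ
  refine Module.Finite.of_surjective (π ∘ₗ V.subtype) fun q ↦ ?_
  obtain ⟨x, rfl⟩ := Submodule.Quotient.mk_surjective _ q
  obtain ⟨v, hv, a, ha, rfl⟩ := Submodule.mem_sup.mp
    (hsup ▸ Submodule.mem_top : x ∈ V ⊔ (gammaLCS K M (i - 1)).toSubmodule)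
  exact ⟨⟨v, hv⟩, (Submodule.Quotient.eq _).mpr (by simpa using ha)⟩
end

section
/- Let K be a field, M a finitely generated Lie algebra over K, and i ≥ 1 a natural number. If γ_{i+1}(M) is finitely generated as a Lie algebra, then γ_s(M) is finitely generated as a Lie algebra for every s with 1 ≤ s ≤ i+1. -/
universe u v

/-- If `J ≤ I` are Lie ideals with `I` spanned by a finite set modulo `J`, and `J` is finitely
generated as a Lie algebra, then so is `I`. -/
theorem LieAlgebraFG.of_le_span_sup {K M : Type*} [Field K] [LieRing M] [LieAlgebra K M]
    {I J : LieIdeal K M} (hJI : J ≤ I) (hJ : LieAlgebraFG K J) {T : Set M} (hT : T.Finite)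
    (hTI : T ⊆ I) (hI : I.toSubmodule ≤ Submodule.span K T ⊔ J.toSubmodule) :
    LieAlgebraFG K I := by
  classical
  obtain ⟨S, hS⟩ := hJ
  let f : J →ₗ⁅K⁆ I := LieIdeal.inclusion hJI
  have hT' : ((Subtype.val : I → M) ⁻¹' T).Finite := hT.preimage Subtype.val_injective.injOn
  refine ⟨S.image f ∪ hT'.toFinset, ?_⟩
  set L := LieSubalgebra.lieSpan K I ↑(S.image f ∪ hT'.toFinset) with hL
  have hsub : (↑(S.image f ∪ hT'.toFinset) : Set I) ⊆ L := LieSubalgebra.subset_lieSpan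
  have hJL : ∀ y, f y ∈ L := by
    have : (⊤ : LieSubalgebra K J) ≤ L.comap f := by
      rw [← hS, LieSubalgebra.lieSpan_le]
      intro y hy
      exact hsub (by simpa using Or.inl ⟨y, y.2, hy, rfl⟩)
    exact fun y => this (LieSubalgebra.mem_top y)
  have hTL : Submodule.span K T ≤ L.toSubmodule.map I.toSubmodule.subtype := by
    rw [Submodule.span_le]
    intro t ht
    exact ⟨⟨t, hTI ht⟩, hsub (by simpa using Or.inr ht), rfl⟩
  rw [eq_top_iff]
  rintro x -
  obtain ⟨t, ht, y, hy, hxy⟩ := Submodule.mem_sup.1 (hI x.2)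
  obtain ⟨t', ht', rfl⟩ := hTL ht
  have : x = t' + f ⟨y, hy⟩ := Subtype.ext hxy.symm
  rw [this]
  exact L.add_mem ht' (hJL _)

section GammaLCS

variable {K M : Type*} [Field K] [LieRing M] [LieAlgebra K M]

theorem lie_mem_gammaLCS_succ {j : ℕ} {a : M} (ha : a ∈ gammaLCS K M j) (m : M) :
    ⁅a, m⁆ ∈ gammaLCS K M (j + 1) :=
  LieSubmodule.lie_mem_lie ha (LieSubmodule.mem_top m)

theorem gammaLCS_succ_le (j : ℕ) : gammaLCS K M (j + 1) ≤ gammaLCS K M j :=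
  LieSubmodule.lie_le_left _ _

theorem gammaLCS_succ_eq_span (j : ℕ) : (gammaLCS K M (j + 1)).toSubmodule =
    Submodule.span K {x | ∃ a ∈ gammaLCS K M j, ∃ m : M, ⁅a, m⁆ = x} := by
  change (⁅gammaLCS K M j, (⊤ : LieIdeal K M)⁆ : LieIdeal K M).toSubmodule = _
  rw [LieSubmodule.lieIdeal_oper_eq_linear_span']
  simp

theorem lie_mem_gammaLCS_add_two {j : ℕ} {a m : M} (ha : a ∈ gammaLCS K M j)
    (hm : m ∈ gammaLCS K M 1) : ⁅a, m⁆ ∈ gammaLCS K M (j + 2) := by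
  have hm' : m ∈ Submodule.span K {x | ∃ b ∈ gammaLCS K M 0, ∃ c : M, ⁅b, c⁆ = x} := by
    rw [← gammaLCS_succ_eq_span]
    exact hm
  induction hm' using Submodule.span_induction with
  | mem x hx =>
    obtain ⟨b, -, c, rfl⟩ := hx
    rw [leibniz_lie, ← lie_skew b]
    exact add_mem (lie_mem_gammaLCS_succ (lie_mem_gammaLCS_succ ha b) c)
      (neg_mem (lie_mem_gammaLCS_succ (lie_mem_gammaLCS_succ ha c) b))
  | zero => simp
  | add x y hx hy ihx ihy =>
    rw [← gammaLCS_succ_eq_span] at hx hy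
    rw [lie_add]
    exact add_mem (ihx hx) (ihy hy)
  | smul r x hx ih =>
    rw [← gammaLCS_succ_eq_span] at hx
    rw [lie_smul]
    exact (gammaLCS K M (j + 2)).smul_mem r (ih hx)

theorem span_sup_gammaLCS_one_eq_top {S : Set M} (hS : LieSubalgebra.lieSpan K M S = ⊤) :
    Submodule.span K S ⊔ (gammaLCS K M 1).toSubmodule = ⊤ := by
  let L : LieSubalgebra K M :=
    { Submodule.span K S ⊔ (gammaLCS K M 1).toSubmodule with
      lie_mem' := fun {x y} _ _ => Submodule.mem_sup_right
        (lie_mem_gammaLCS_succ (j := 0) (LieSubmodule.mem_top x) y) }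
  have hL : LieSubalgebra.lieSpan K M S ≤ L := LieSubalgebra.lieSpan_le.2
    fun x hx => Submodule.mem_sup_left (Submodule.subset_span hx)
  rw [eq_top_iff]
  intro x _
  exact hL (hS ▸ LieSubalgebra.mem_top x)

theorem exists_finite_gammaLCS_le_span_sup (hM : LieAlgebraFG K M) (j : ℕ) :
    ∃ T : Set M, T.Finite ∧ T ⊆ gammaLCS K M j ∧ (gammaLCS K M j).toSubmodule ≤
      Submodule.span K T ⊔ (gammaLCS K M (j + 1)).toSubmodule := by
  obtain ⟨S, hS⟩ := hM
  have hS' := span_sup_gammaLCS_one_eq_top hS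
  induction j with
  | zero =>
    exact ⟨S, S.finite_toSet, fun x _ => LieSubmodule.mem_top x, le_of_le_of_eq le_top hS'.symm⟩
  | succ j ih =>
    obtain ⟨T, hT, hTj, hle⟩ := ih
    refine ⟨Set.image2 (fun t s => ⁅t, s⁆) T S, hT.image2 _ S.finite_toSet, ?_, ?_⟩
    · rintro _ ⟨t, ht, s, -, rfl⟩
      exact lie_mem_gammaLCS_succ (hTj ht) s
    · rw [gammaLCS_succ_eq_span j, Submodule.span_le]
      rintro _ ⟨a, ha, m, rfl⟩
      obtain ⟨t, ht, a', ha', rfl⟩ := Submodule.mem_sup.1 (hle ha)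
      obtain ⟨s, hs, m', hm', rfl⟩ := Submodule.mem_sup.1 (hS' ▸ Submodule.mem_top : m ∈ _)
      have htj : t ∈ gammaLCS K M j :=
        (Submodule.span_le (p := (gammaLCS K M j).toSubmodule)).2 hTj ht
      rw [add_lie, lie_add]
      refine add_mem (add_mem (Submodule.mem_sup_left ?_) (Submodule.mem_sup_right ?_))
        (Submodule.mem_sup_right (lie_mem_gammaLCS_succ ha' _))
      · have := Submodule.apply_mem_map₂ (LieModule.toEnd K M M : M →ₗ[K] M →ₗ[K] M) ht hs
        rwa [Submodule.map₂_span_span] at this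
      · exact lie_mem_gammaLCS_add_two htj hm'

end GammaLCS

theorem gamma_fg_below (K : Type*) [Field K] (M : Type u) [LieRing M] [LieAlgebra K M]
    (hM : LieAlgebraFG K M) (i : ℕ) (hi : 1 ≤ i)
    (hγ : LieAlgebraFG K ↑(gammaLCS K M i)) :
    ∀ s : ℕ, 1 ≤ s → s ≤ i + 1 → LieAlgebraFG K ↑(gammaLCS K M (s - 1)) := by
  have key : ∀ d, d ≤ i → LieAlgebraFG K ↑(gammaLCS K M (i - d)) := by
    intro d
    induction d with
    | zero => exact fun _ => hγ
    | succ d ih =>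
      intro hd
      obtain ⟨T, hT, hTj, hle⟩ := exists_finite_gammaLCS_le_span_sup hM (i - (d + 1))
      have hsucc : i - (d + 1) + 1 = i - d := by omega
      refine LieAlgebraFG.of_le_span_sup (gammaLCS_succ_le _) ?_ hT hTj hle
      rw [hsucc]
      exact ih (by omega)
  intro s hs hsi
  have hs' : s - 1 = i - (i + 1 - s) := by omega
  rw [hs']
  exact key _ (by omega)
end

section
/- Let K be a field, M a finitely presented Lie algebra over K, i ≥ 1 a natural number, and 0 → R → L → M → 0 any i-central extension of Lie algebras over K. Then γ_{i+1}(L) is finitely presented if and only if γ_{i+1}(M) is finitely presented. -/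
universe u v

theorem FreeLieAlgebra.lieSpan_range_of (K X : Type*) [Field K] :
    LieSubalgebra.lieSpan K (FreeLieAlgebra K X) (Set.range (FreeLieAlgebra.of K)) = ⊤ := by
  set B := LieSubalgebra.lieSpan K (FreeLieAlgebra K X) (Set.range (FreeLieAlgebra.of K))
  let g : FreeLieAlgebra K X →ₗ⁅K⁆ B :=
    FreeLieAlgebra.lift K fun x ↦ ⟨FreeLieAlgebra.of K x, LieSubalgebra.subset_lieSpan ⟨x, rfl⟩⟩
  have hg : B.incl.comp g = LieHom.id := by
    ext x
    simp [g]
  rw [eq_top_iff]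
  intro x _
  have hx : (g x : FreeLieAlgebra K X) = x := LieHom.congr_fun hg x
  exact hx ▸ (g x).2

theorem FreeLieAlgebra.mem_of_forall_of_mem {K X : Type*} [Field K]
    (B : LieSubalgebra K (FreeLieAlgebra K X)) (h : ∀ x, FreeLieAlgebra.of K x ∈ B)
    (w : FreeLieAlgebra K X) : w ∈ B := by
  have hle : LieSubalgebra.lieSpan K (FreeLieAlgebra K X) (Set.range (FreeLieAlgebra.of K)) ≤ B :=
    LieSubalgebra.lieSpan_le.mpr (by rintro _ ⟨x, rfl⟩; exact h x)
  exact hle (FreeLieAlgebra.lieSpan_range_of K X ▸ LieSubalgebra.mem_top w)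

theorem FreeLieAlgebra.exists_sub_mem {K X A : Type*} [Field K] [LieRing A] [LieAlgebra K A]
    (φ : A →ₗ⁅K⁆ FreeLieAlgebra K X) (C : LieIdeal K (FreeLieAlgebra K X))
    (h : ∀ x, ∃ u, FreeLieAlgebra.of K x - φ u ∈ C) (w : FreeLieAlgebra K X) :
    ∃ u, w - φ u ∈ C := by
  let B : LieSubalgebra K (FreeLieAlgebra K X) :=
    { carrier := {w | ∃ u, w - φ u ∈ C}
      zero_mem' := ⟨0, by simp⟩
      add_mem' := by
        rintro x y ⟨u, hu⟩ ⟨v, hv⟩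
        refine ⟨u + v, ?_⟩
        rw [map_add, add_sub_add_comm]
        exact add_mem hu hv
      smul_mem' := by
        rintro c x ⟨u, hu⟩
        refine ⟨c • u, ?_⟩
        rw [map_smul, ← smul_sub]
        exact SMulMemClass.smul_mem c hu
      lie_mem' := by
        rintro x y ⟨u, hu⟩ ⟨v, hv⟩
        refine ⟨⁅u, v⁆, ?_⟩
        have hxy : ⁅x, y⁆ - φ ⁅u, v⁆ = ⁅x - φ u, y⁆ + ⁅φ u, y - φ v⁆ := by
          rw [LieHom.map_lie, sub_lie, lie_sub]
          abel
        rw [hxy]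
        exact add_mem (lie_mem_left K _ C _ _ hu) (lie_mem_right K _ C _ _ hv) }
  exact FreeLieAlgebra.mem_of_forall_of_mem B h w

theorem LieAlgebraFP.of_presentation {K A X : Type*} [Field K] [LieRing A] [LieAlgebra K A]
    [Finite X] (f : FreeLieAlgebra K X →ₗ⁅K⁆ A) (hf : Function.Surjective f)
    (T : Set (FreeLieAlgebra K X)) (hT : T.Finite)
    (hker : f.ker = LieSubmodule.lieSpan K (FreeLieAlgebra K X) T) : LieAlgebraFP K A := by
  classical
  obtain ⟨n, ⟨e⟩⟩ := Finite.exists_equiv_fin X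
  let E : FreeLieAlgebra K X →ₗ⁅K⁆ FreeLieAlgebra K (Fin n) :=
    FreeLieAlgebra.lift K (FreeLieAlgebra.of K ∘ e)
  let E' : FreeLieAlgebra K (Fin n) →ₗ⁅K⁆ FreeLieAlgebra K X :=
    FreeLieAlgebra.lift K (FreeLieAlgebra.of K ∘ e.symm)
  have hEE' (x) : E (E' x) = x := by
    have : E.comp E' = LieHom.id := by
      ext x
      simp [E, E']
    exact LieHom.congr_fun this x
  have hE'E (x) : E' (E x) = x := by
    have : E'.comp E = LieHom.id := by
      ext x
      simp [E, E']
    exact LieHom.congr_fun this x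
  let g := f.comp E'
  have hg : Function.Surjective g := fun a ↦ by
    obtain ⟨x, rfl⟩ := hf a
    exact ⟨E x, congrArg f (hE'E x)⟩
  have hgker : LieSubmodule.lieSpan K (FreeLieAlgebra K (Fin n)) (E '' T) = g.ker := by
    apply le_antisymm
    · rw [LieSubmodule.lieSpan_le]
      rintro _ ⟨t, ht, rfl⟩
      have htf : t ∈ f.ker := hker ▸ LieSubmodule.subset_lieSpan ht
      simpa [g, hE'E] using htf
    · intro x hx
      have hle : LieSubmodule.lieSpan K (FreeLieAlgebra K X) T ≤
          LieIdeal.comap E (LieSubmodule.lieSpan K (FreeLieAlgebra K (Fin n)) (E '' T)) :=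
        LieSubmodule.lieSpan_le.mpr fun t ht ↦ LieSubmodule.subset_lieSpan ⟨t, ht, rfl⟩
      have hx' : E' x ∈ f.ker := hx
      have hEx : E (E' x) ∈ LieSubmodule.lieSpan K (FreeLieAlgebra K (Fin n)) (E '' T) :=
        hle (hker ▸ hx')
      rwa [hEE'] at hEx
  refine ⟨n, (hT.image E).toFinset, ?_⟩
  rw [Set.Finite.coe_toFinset, hgker]
  refine ⟨g.quotKerEquivRange.trans (LieEquiv.ofBijective g.range.incl
    ⟨Subtype.val_injective, fun a ↦ ?_⟩)⟩
  obtain ⟨x, rfl⟩ := hg a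
  exact ⟨⟨g x, x, rfl⟩, rfl⟩

theorem LieAlgebraFP.exists_presentation {K A : Type*} [Field K] [LieRing A] [LieAlgebra K A]
    (h : LieAlgebraFP K A) :
    ∃ (n : ℕ) (f : FreeLieAlgebra K (Fin n) →ₗ⁅K⁆ A) (T : Set (FreeLieAlgebra K (Fin n))),
      Function.Surjective f ∧ T.Finite ∧
        f.ker = LieSubmodule.lieSpan K (FreeLieAlgebra K (Fin n)) T := by
  obtain ⟨n, S, ⟨e⟩⟩ := h
  let q : FreeLieAlgebra K (Fin n) →ₗ⁅K⁆ FreeLieAlgebra K (Fin n) ⧸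
      (LieSubmodule.lieSpan K (FreeLieAlgebra K (Fin n)) (S : Set (FreeLieAlgebra K (Fin n))) :
        LieIdeal K (FreeLieAlgebra K (Fin n))) :=
    { (LieSubmodule.lieSpan K (FreeLieAlgebra K (Fin n))
        (S : Set (FreeLieAlgebra K (Fin n)))).toSubmodule.mkQ with
      map_lie' := fun {x y} ↦ LieSubmodule.Quotient.mk_bracket _ x y }
  refine ⟨n, (e : _ →ₗ⁅K⁆ A).comp q, S, ?_, S.finite_toSet, ?_⟩
  · exact e.surjective.comp Quot.mk_surjective
  · ext x
    rw [LieHom.mem_ker]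
    change e (q x) = 0 ↔ _
    rw [← e.toLieHom.map_zero]
    refine e.injective.eq_iff.trans ?_
    exact LieSubmodule.Quotient.mk_eq_zero'

/-- A quotient of a finitely presented Lie algebra by a finite-dimensional ideal is finitely
presented. -/
theorem LieAlgebraFP.of_surjective_of_finite_ker {K N Q : Type*} [Field K]
    [LieRing N] [LieAlgebra K N] [LieRing Q] [LieAlgebra K Q] (p : N →ₗ⁅K⁆ Q)
    (hp : Function.Surjective p) (Z : Set N) (hZ : Z.Finite)
    (hker : p.ker.toSubmodule = Submodule.span K Z) (hN : LieAlgebraFP K N) :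
    LieAlgebraFP K Q := by
  obtain ⟨n, f, T, hf, hT, hfker⟩ := hN.exists_presentation
  let s := Function.surjInv hf
  have hs (x) : f (s x) = x := Function.surjInv_eq hf x
  refine of_presentation (p.comp f) (hp.comp hf) (T ∪ s '' Z) (hT.union (hZ.image s)) ?_
  apply le_antisymm
  · set J := LieSubmodule.lieSpan K (FreeLieAlgebra K (Fin n)) (T ∪ s '' Z)
    have hTJ : f.ker ≤ J := hfker ▸ LieSubmodule.lieSpan_mono Set.subset_union_left
    have hle : Submodule.span K Z ≤ J.toSubmodule.map (f : FreeLieAlgebra K (Fin n) →ₗ[K] N) :=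
      Submodule.span_le.mpr fun z hz ↦
        ⟨s z, LieSubmodule.subset_lieSpan (Or.inr ⟨z, hz, rfl⟩), hs z⟩
    intro w hw
    have hw' : f w ∈ p.ker.toSubmodule := hw
    obtain ⟨j, hj, hjw⟩ := hle (hker ▸ hw')
    have : w - j ∈ f.ker := by
      rw [LieHom.mem_ker, map_sub, sub_eq_zero]
      exact hjw.symm
    simpa using add_mem (hTJ this) (show j ∈ J from hj)
  · rw [LieSubmodule.lieSpan_le]
    rintro _ (ht | ⟨z, hz, rfl⟩)
    · have : _ ∈ f.ker := hfker ▸ LieSubmodule.subset_lieSpan ht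
      rw [LieHom.mem_ker] at this
      simp [this]
    · have : z ∈ p.ker.toSubmodule := hker ▸ Submodule.subset_span hz
      have hpz : p z = 0 := this
      simp [hs, hpz]

/-- A central extension of a finitely presented Lie algebra by a finite-dimensional one is
finitely presented. -/
theorem LieAlgebraFP.of_central_ext {K N Q : Type*} [Field K]
    [LieRing N] [LieAlgebra K N] [LieRing Q] [LieAlgebra K Q] (p : N →ₗ⁅K⁆ Q)
    (hp : Function.Surjective p) (hfin : FiniteDimensional K p.ker.toSubmodule)
    (hcent : ∀ z ∈ p.ker, ∀ x : N, ⁅z, x⁆ = 0) (hQ : LieAlgebraFP K Q) :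
    LieAlgebraFP K N := by
  obtain ⟨n, f, T, hf, hT, hfker⟩ := hQ.exists_presentation
  let b := Module.finBasis K p.ker.toSubmodule
  set d := Module.finrank K p.ker.toSubmodule
  let X : Fin n → N := fun k ↦ Function.surjInv hp (f (FreeLieAlgebra.of K k))
  let G : FreeLieAlgebra K (Fin n) →ₗ⁅K⁆ N := FreeLieAlgebra.lift K X
  let g : FreeLieAlgebra K (Fin n ⊕ Fin d) →ₗ⁅K⁆ N :=
    FreeLieAlgebra.lift K (Sum.elim X fun l ↦ (b l : N))
  let ι : FreeLieAlgebra K (Fin n) →ₗ⁅K⁆ FreeLieAlgebra K (Fin n ⊕ Fin d) :=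
    FreeLieAlgebra.lift K fun k ↦ FreeLieAlgebra.of K (Sum.inl k)
  let σ : p.ker.toSubmodule →ₗ[K] FreeLieAlgebra K (Fin n ⊕ Fin d) :=
    b.constr K fun l ↦ FreeLieAlgebra.of K (Sum.inr l)
  have hσb (l) : σ (b l) = FreeLieAlgebra.of K (Sum.inr l) := b.constr_basis K _ l
  have hgι (u) : g (ι u) = G u := by
    have : g.comp ι = G := by
      ext k
      simp [g, ι, G]
    exact LieHom.congr_fun this u
  have hpG (u) : p (G u) = f u := by
    have : p.comp G = f := by
      ext k
      simp [G, X, Function.surjInv_eq hp]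
    exact LieHom.congr_fun this u
  have hgσ (z) : g (σ z) = z := by
    have : (g : _ →ₗ[K] N).comp σ = p.ker.toSubmodule.subtype := by
      refine b.ext fun l ↦ ?_
      change g (σ (b l)) = b l
      rw [hσb]
      simp [g]
    exact LinearMap.congr_fun this z
  have hGT {t} (ht : t ∈ T) : G t ∈ p.ker.toSubmodule := by
    have : t ∈ f.ker := hfker ▸ LieSubmodule.subset_lieSpan ht
    change p (G t) = 0
    rw [hpG]
    exact this
  let E₁ : Set (FreeLieAlgebra K (Fin n ⊕ Fin d)) :=
    Set.range fun ly : Fin d × (Fin n ⊕ Fin d) ↦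
      ⁅(FreeLieAlgebra.of K (Sum.inr ly.1) : FreeLieAlgebra K (Fin n ⊕ Fin d)),
        FreeLieAlgebra.of K ly.2⁆
  let E₂ : Set (FreeLieAlgebra K (Fin n ⊕ Fin d)) :=
    Set.range fun t : T ↦ ι t - σ ⟨G t, hGT t.2⟩
  have : Finite T := hT
  set J : LieIdeal K (FreeLieAlgebra K (Fin n ⊕ Fin d)) :=
    LieSubmodule.lieSpan K (FreeLieAlgebra K (Fin n ⊕ Fin d)) (E₁ ∪ E₂) with hJ
  have hbJ (l : Fin d) (w) :
      ⁅(FreeLieAlgebra.of K (Sum.inr l) : FreeLieAlgebra K (Fin n ⊕ Fin d)), w⁆ ∈ J := by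
    let B : LieSubalgebra K (FreeLieAlgebra K (Fin n ⊕ Fin d)) :=
      { J.toSubmodule.comap (LieAlgebra.ad K _ (FreeLieAlgebra.of K (Sum.inr l))) with
        lie_mem' := by
          intro x y hx hy
          change ⁅(FreeLieAlgebra.of K (Sum.inr l) : FreeLieAlgebra K (Fin n ⊕ Fin d)),
            ⁅x, y⁆⁆ ∈ J
          rw [leibniz_lie]
          exact add_mem (lie_mem_left K _ J _ _ hx) (lie_mem_right K _ J _ _ hy) }
    refine FreeLieAlgebra.mem_of_forall_of_mem B (fun y ↦ ?_) w
    exact LieSubmodule.subset_lieSpan (Or.inl ⟨(l, y), rfl⟩)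
  have hσJ (w : FreeLieAlgebra K (Fin n ⊕ Fin d)) (z) : ⁅w, σ z⁆ ∈ J := by
    have hle : (⊤ : Submodule K p.ker.toSubmodule) ≤
        J.toSubmodule.comap (LieAlgebra.ad K _ w ∘ₗ σ) := by
      rw [← b.span_eq, Submodule.span_le]
      rintro _ ⟨l, rfl⟩
      change ⁅w, σ (b l)⁆ ∈ J
      rw [hσb, ← lie_skew]
      exact neg_mem (hbJ l w)
    exact hle (Submodule.mem_top (x := z))
  let C : LieIdeal K (FreeLieAlgebra K (Fin n ⊕ Fin d)) :=
    { LinearMap.range σ ⊔ J.toSubmodule with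
      lie_mem := by
        intro x m hm
        obtain ⟨_, ⟨z, rfl⟩, j, hj, rfl⟩ := Submodule.mem_sup.mp hm
        rw [lie_add]
        exact Submodule.mem_sup_right (add_mem (hσJ x z) (lie_mem_right K _ J _ _ hj)) }
  have hσC (z) : σ z ∈ C := Submodule.mem_sup_left (LinearMap.mem_range_self σ z)
  have hJC : J ≤ C := fun j hj ↦ Submodule.mem_sup_right hj
  have hιC (u) (hu : u ∈ f.ker) : ι u ∈ C := by
    have hle : LieSubmodule.lieSpan K (FreeLieAlgebra K (Fin n)) T ≤ LieIdeal.comap ι C := by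
      rw [LieSubmodule.lieSpan_le]
      intro t ht
      have h₁ : ι t - σ ⟨G t, hGT ht⟩ ∈ C :=
        hJC (LieSubmodule.subset_lieSpan (Or.inr ⟨⟨t, ht⟩, rfl⟩))
      have h₂ := add_mem h₁ (hσC ⟨G t, hGT ht⟩)
      rw [sub_add_cancel] at h₂
      exact h₂
    exact hle (hfker ▸ hu)
  have hdecomp := FreeLieAlgebra.exists_sub_mem ι C fun y ↦ by
    rcases y with k | l
    · exact ⟨FreeLieAlgebra.of K k, by simp [ι]⟩
    · exact ⟨0, by rw [map_zero, sub_zero, ← hσb]; exact hσC (b l)⟩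
  have hJg : J ≤ g.ker := by
    rw [hJ, LieSubmodule.lieSpan_le]
    rintro _ (⟨⟨l, y⟩, rfl⟩ | ⟨t, rfl⟩)
    · have hz : ((b l : p.ker.toSubmodule) : N) ∈ p.ker := (b l).2
      have hgl : g (FreeLieAlgebra.of K (Sum.inr l)) = b l := by simp [g]
      change g ⁅_, _⁆ = 0
      rw [LieHom.map_lie, hgl, hcent _ hz]
    · change g (ι t - σ _) = 0
      rw [map_sub, hgι, hgσ, sub_self]
  refine of_presentation g (fun x ↦ ?_) (E₁ ∪ E₂)
    ((Set.finite_range _).union (Set.finite_range _)) (le_antisymm (fun w hw ↦ ?_) hJg)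
  · obtain ⟨u, hu⟩ := hf (p x)
    have hx : x - G u ∈ p.ker.toSubmodule := by
      change p (x - G u) = 0
      rw [map_sub, hpG, hu, sub_self]
    refine ⟨ι u + σ ⟨_, hx⟩, ?_⟩
    rw [map_add, hgι, hgσ]
    simp
  · have hgw : g w = 0 := hw
    have hgC {c} (hc : c ∈ C) : p (g c) = 0 := by
      obtain ⟨_, ⟨z, rfl⟩, j, hj, rfl⟩ := Submodule.mem_sup.mp hc
      have hj0 : g j = 0 := hJg hj
      rw [map_add, hj0, add_zero, hgσ]
      exact z.2
    obtain ⟨u, hu⟩ := hdecomp w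
    have hfu : u ∈ f.ker := by
      have := hgC hu
      rw [map_sub, hgw, hgι, zero_sub, map_neg, hpG, neg_eq_zero] at this
      exact this
    have hwC : w ∈ C := by simpa using add_mem hu (hιC u hfu)
    obtain ⟨_, ⟨z, rfl⟩, j, hj, rfl⟩ := Submodule.mem_sup.mp hwC
    have hj0 : g j = 0 := hJg hj
    rw [map_add, hj0, add_zero, hgσ] at hgw
    obtain rfl : z = 0 := Subtype.ext hgw
    rw [map_zero, zero_add]
    exact hj

/-- If `I / ⁅I, F⁆` is finite-dimensional and `F` is finitely generated, then
`⁅I, F⁆ / ⁅⁅I, F⁆, F⁆` is finite-dimensional. -/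
theorem LieIdeal.exists_finite_span_sup_lie_top {K F : Type*} [Field K] [LieRing F]
    [LieAlgebra K F] {Y : Set F} (hY : Y.Finite) (hgen : LieSubalgebra.lieSpan K F Y = ⊤)
    (I : LieIdeal K F) {T : Set F} (hT : T.Finite) (hTI : T ⊆ I)
    (hI : I.toSubmodule ≤ Submodule.span K T ⊔ ⁅I, (⊤ : LieIdeal K F)⁆.toSubmodule) :
    ∃ T' : Set F, T'.Finite ∧ T' ⊆ (⁅I, (⊤ : LieIdeal K F)⁆ : LieIdeal K F) ∧
      ⁅I, (⊤ : LieIdeal K F)⁆.toSubmodule ≤ Submodule.span K T' ⊔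
        ⁅⁅I, (⊤ : LieIdeal K F)⁆, (⊤ : LieIdeal K F)⁆.toSubmodule := by
  set I₁ := ⁅I, (⊤ : LieIdeal K F)⁆ with hI₁
  set I₂ := ⁅I₁, (⊤ : LieIdeal K F)⁆
  have h₁ {r x} (hr : r ∈ I) : ⁅r, x⁆ ∈ I₁ := LieSubmodule.lie_mem_lie hr (LieSubmodule.mem_top x)
  have h₂ {r x} (hr : r ∈ I₁) : ⁅r, x⁆ ∈ I₂ := LieSubmodule.lie_mem_lie hr (LieSubmodule.mem_top x)
  set T' : Set F := Set.image2 (fun t y ↦ ⁅t, y⁆) T Y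
  have hgenT {t} (ht : t ∈ T) (x : F) : ⁅t, x⁆ ∈ Submodule.span K T' ⊔ I₂.toSubmodule := by
    let B : LieSubalgebra K F :=
      { (Submodule.span K T' ⊔ I₂.toSubmodule).comap (LieAlgebra.ad K F t) with
        lie_mem' := by
          intro x y _ _
          change ⁅t, ⁅x, y⁆⁆ ∈ Submodule.span K T' ⊔ I₂.toSubmodule
          rw [leibniz_lie]
          refine Submodule.mem_sup_right (add_mem (h₂ (h₁ (hTI ht))) ?_)
          rw [← lie_skew]
          exact neg_mem (h₂ (h₁ (hTI ht))) }
    have hle : LieSubalgebra.lieSpan K F Y ≤ B := LieSubalgebra.lieSpan_le.mpr fun y hy ↦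
      Submodule.mem_sup_left (Submodule.subset_span ⟨t, ht, y, hy, rfl⟩)
    exact hle (hgen ▸ LieSubalgebra.mem_top x)
  refine ⟨T', hT.image2 _ hY, ?_, ?_⟩
  · rintro _ ⟨t, ht, y, _, rfl⟩
    exact h₁ (hTI ht)
  · conv_lhs => rw [hI₁, LieSubmodule.lieIdeal_oper_eq_linear_span']
    rw [Submodule.span_le]
    rintro _ ⟨r, hr, x, -, rfl⟩
    obtain ⟨s, hs, r', hr', rfl⟩ := Submodule.mem_sup.mp (hI hr)
    change ⁅s + r', x⁆ ∈ Submodule.span K T' ⊔ I₂.toSubmodule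
    rw [add_lie]
    refine add_mem ?_ (Submodule.mem_sup_right (h₂ hr'))
    clear hr
    induction hs using Submodule.span_induction with
    | mem t ht => exact hgenT ht x
    | zero => simp
    | add a b _ _ ha hb => rw [add_lie]; exact add_mem ha hb
    | smul c a _ ha => rw [smul_lie]; exact Submodule.smul_mem _ c ha

theorem gammaRel_succ_le_s12 {K L : Type*} [Field K] [LieRing L] [LieAlgebra K L]
    (R : LieIdeal K L) (j : ℕ) : gammaRel K L R (j + 1) ≤ gammaRel K L R j :=
  LieSubmodule.lie_le_left _ _

/-- A finitely generated ideal `I` of a finitely generated Lie algebra has finite-dimensional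
quotients `I / γ_j(I, F)`. -/
theorem exists_finite_span_sup_gammaRel {K F : Type*} [Field K] [LieRing F]
    [LieAlgebra K F] {Y : Set F} (hY : Y.Finite) (hgen : LieSubalgebra.lieSpan K F Y = ⊤)
    {T : Set F} (hT : T.Finite) (j : ℕ) :
    ∃ U : Set F, U.Finite ∧ (LieSubmodule.lieSpan K F T).toSubmodule ≤
      Submodule.span K U ⊔ (gammaRel K F (LieSubmodule.lieSpan K F T) j).toSubmodule := by
  set I : LieIdeal K F := LieSubmodule.lieSpan K F T
  have hstep : ∀ j, ∃ U : Set F, U.Finite ∧ U ⊆ gammaRel K F I j ∧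
      (gammaRel K F I j).toSubmodule ≤
        Submodule.span K U ⊔ (gammaRel K F I (j + 1)).toSubmodule := by
    intro j
    induction j with
    | zero =>
      refine ⟨T, hT, LieSubmodule.subset_lieSpan, ?_⟩
      have hTI : Submodule.span K T ≤ I.toSubmodule :=
        Submodule.span_le.mpr LieSubmodule.subset_lieSpan
      let D : LieIdeal K F :=
        { Submodule.span K T ⊔ (gammaRel K F I 1).toSubmodule with
          lie_mem := by
            intro x m hm
            refine Submodule.mem_sup_right ?_
            have hmI : m ∈ I := sup_le hTI (gammaRel_succ_le_s12 I 0) hm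
            rw [← lie_skew]
            exact neg_mem (LieSubmodule.lie_mem_lie hmI (LieSubmodule.mem_top x)) }
      have hle : I ≤ D := LieSubmodule.lieSpan_le.mpr fun t ht ↦
        Submodule.mem_sup_left (Submodule.subset_span ht)
      exact hle
    | succ j ih =>
      obtain ⟨U, hU, hUI, hle⟩ := ih
      exact LieIdeal.exists_finite_span_sup_lie_top hY hgen _ hU hUI hle
  induction j with
  | zero => exact ⟨∅, Set.finite_empty, le_sup_right⟩
  | succ j ih =>
    obtain ⟨U, hU, hle⟩ := ih
    obtain ⟨V, hV, -, hle'⟩ := hstep j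
    refine ⟨U ∪ V, hU.union hV, hle.trans ?_⟩
    rw [Submodule.span_union, sup_assoc]
    exact sup_le_sup_left hle' _

theorem LieIdeal.lie_lie_top_le {K L : Type*} [Field K] [LieRing L] [LieAlgebra K L]
    (I J : LieIdeal K L) :
    ⁅I, ⁅J, (⊤ : LieIdeal K L)⁆⁆ ≤ ⁅⁅I, J⁆, (⊤ : LieIdeal K L)⁆ ⊔ ⁅⁅I, (⊤ : LieIdeal K L)⁆, J⁆ := by
  rw [LieSubmodule.lie_le_iff]
  intro x hx m hm
  rw [← LieSubmodule.mem_toSubmodule, LieSubmodule.lieIdeal_oper_eq_linear_span'] at hm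
  induction hm using Submodule.span_induction with
  | mem m hm =>
    obtain ⟨a, ha, b, hb, rfl⟩ := hm
    rw [leibniz_lie]
    have h₁ := LieSubmodule.lie_mem_lie (LieSubmodule.lie_mem_lie hx ha) hb
    have h₂ := LieSubmodule.lie_mem_lie (LieSubmodule.lie_mem_lie hx (LieSubmodule.mem_top b)) ha
    refine add_mem (SetLike.le_def.mp le_sup_left h₁) ?_
    rw [← lie_skew]
    exact neg_mem (SetLike.le_def.mp le_sup_right h₂)
  | zero => simp
  | add a b _ _ ha hb => rw [lie_add]; exact add_mem ha hb
  | smul c a _ ha => rw [lie_smul]; exact SMulMemClass.smul_mem c ha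

theorem lie_gammaRel_gammaLCS_le {K L : Type*} [Field K] [LieRing L] [LieAlgebra K L]
    (R : LieIdeal K L) (j k : ℕ) :
    ⁅gammaRel K L R k, gammaLCS K L j⁆ ≤ gammaRel K L R (k + j + 1) := by
  induction j generalizing k with
  | zero => exact le_rfl
  | succ j ih =>
    refine (LieIdeal.lie_lie_top_le _ _).trans (sup_le ?_ ?_)
    · exact LieSubmodule.mono_lie_left _ (ih k)
    · exact (ih (k + 1)).trans (by rw [show k + 1 + j + 1 = k + (j + 1) + 1 by omega])

theorem map_mem_gammaRel {K F L : Type*} [Field K] [LieRing F] [LieAlgebra K F] [LieRing L]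
    [LieAlgebra K L] (φ : F →ₗ⁅K⁆ L) {S : LieIdeal K F} {R : LieIdeal K L}
    (h : ∀ x ∈ S, φ x ∈ R) (j : ℕ) {x : F} (hx : x ∈ gammaRel K F S j) :
    φ x ∈ gammaRel K L R j := by
  suffices hle : gammaRel K F S j ≤ LieIdeal.comap φ (gammaRel K L R j) from hle hx
  clear hx
  induction j with
  | zero => exact h
  | succ j ih =>
    exact (LieSubmodule.mono_lie ih le_top).trans (LieIdeal.comap_bracket_le φ (J₂ := ⊤))

theorem exists_map_eq_of_mem_gammaLCS {K F L : Type*} [Field K] [LieRing F] [LieAlgebra K F]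
    [LieRing L] [LieAlgebra K L] (φ : F →ₗ⁅K⁆ L) (R : LieIdeal K L)
    (h : ∀ x, ∃ u, x - φ u ∈ R) (j : ℕ) {x : L} (hx : x ∈ gammaLCS K L j) :
    ∃ u ∈ gammaLCS K F j, x - φ u ∈ gammaRel K L R j := by
  induction j generalizing x with
  | zero =>
    obtain ⟨u, hu⟩ := h x
    exact ⟨u, LieSubmodule.mem_top u, hu⟩
  | succ j ih =>
    change x ∈ ⁅gammaLCS K L j, (⊤ : LieIdeal K L)⁆ at hx
    rw [← LieSubmodule.mem_toSubmodule, LieSubmodule.lieIdeal_oper_eq_linear_span'] at hx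
    induction hx using Submodule.span_induction with
    | mem m hm =>
      obtain ⟨a, ha, b, -, rfl⟩ := hm
      obtain ⟨u, hu, hau⟩ := ih ha
      obtain ⟨v, hbv⟩ := h b
      refine ⟨⁅u, v⁆, LieSubmodule.lie_mem_lie hu (LieSubmodule.mem_top v), ?_⟩
      have heq : ⁅a, b⁆ - φ ⁅u, v⁆ = ⁅a - φ u, φ v⁆ - ⁅b - φ v, a⁆ := by
        rw [LieHom.map_lie, ← lie_skew (b - φ v) a, sub_lie, lie_sub]
        abel
      rw [heq]
      refine sub_mem (LieSubmodule.lie_mem_lie hau (LieSubmodule.mem_top _)) ?_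
      have := lie_gammaRel_gammaLCS_le R j 0 (LieSubmodule.lie_mem_lie hbv ha)
      rwa [zero_add] at this
    | zero => exact ⟨0, zero_mem _, by simp⟩
    | add a b _ _ ha hb =>
      obtain ⟨u, hu, hau⟩ := ha
      obtain ⟨v, hv, hbv⟩ := hb
      refine ⟨u + v, add_mem hu hv, ?_⟩
      rw [map_add, add_sub_add_comm]
      exact add_mem hau hbv
    | smul c a _ ha =>
      obtain ⟨u, hu, hau⟩ := ha
      refine ⟨c • u, SMulMemClass.smul_mem c hu, ?_⟩
      rw [map_smul, ← smul_sub]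
      exact SMulMemClass.smul_mem c hau

/-- The homomorphism `γ_{i+1}(L) → γ_{i+1}(M)` induced by `L → M`. -/
def gammaLCSMap {K L M : Type*} [Field K] [LieRing L] [LieAlgebra K L] [LieRing M]
    [LieAlgebra K M] (π : L →ₗ⁅K⁆ M) (i : ℕ) : gammaLCS K L i →ₗ⁅K⁆ gammaLCS K M i where
  toFun x := ⟨π x, map_mem_gammaRel π (fun _ _ ↦ LieSubmodule.mem_top _) i x.2⟩
  map_add' _ _ := Subtype.ext (map_add π _ _)
  map_smul' _ _ := Subtype.ext (map_smul π _ _)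
  map_lie' := Subtype.ext (π.map_lie _ _)

theorem gammaLCSMap_surjective {K L M : Type*} [Field K] [LieRing L] [LieAlgebra K L] [LieRing M]
    [LieAlgebra K M] (π : L →ₗ⁅K⁆ M) (hπ : Function.Surjective π) (i : ℕ) :
    Function.Surjective (gammaLCSMap π i) := by
  rintro ⟨y, hy⟩
  have hbot : ∀ j, gammaRel K M (⊥ : LieIdeal K M) j = ⊥ := by
    intro j
    induction j with
    | zero => rfl
    | succ j ih => rw [gammaRel, ih, LieSubmodule.bot_lie]
  obtain ⟨u, hu, hyu⟩ := exists_map_eq_of_mem_gammaLCS π ⊥ (fun x ↦ by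
    obtain ⟨u, rfl⟩ := hπ x
    exact ⟨u, by simp⟩) i hy
  rw [hbot, LieSubmodule.mem_bot, sub_eq_zero] at hyu
  exact ⟨⟨u, hu⟩, Subtype.ext hyu.symm⟩

theorem finiteDimensional_ker_gammaLCSMap {K L M : Type*} [Field K] [LieRing L] [LieAlgebra K L]
    [LieRing M] [LieAlgebra K M] (hM : LieAlgebraFP K M) (π : L →ₗ⁅K⁆ M)
    (hπ : Function.Surjective π) (i : ℕ) (hcent : gammaRel K L π.ker i = ⊥) :
    FiniteDimensional K (gammaLCSMap π i).ker.toSubmodule := by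
  obtain ⟨n, f, T, hf, hT, hker⟩ := hM.exists_presentation
  let φ : FreeLieAlgebra K (Fin n) →ₗ⁅K⁆ L :=
    FreeLieAlgebra.lift K fun k ↦ Function.surjInv hπ (f (FreeLieAlgebra.of K k))
  have hφ (u) : π (φ u) = f u := by
    have : π.comp φ = f := by
      ext k
      simp [φ, Function.surjInv_eq hπ]
    exact LieHom.congr_fun this u
  obtain ⟨U, hU, hle⟩ := exists_finite_span_sup_gammaRel (Set.finite_range (FreeLieAlgebra.of K))
    (FreeLieAlgebra.lieSpan_range_of K (Fin n)) hT i
  rw [← hker] at hle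
  have hfd : FiniteDimensional K (Submodule.span K (φ '' U)) :=
    FiniteDimensional.span_of_finite K (hU.image φ)
  have hmem (x : (gammaLCSMap π i).ker.toSubmodule) : (x.1 : L) ∈ Submodule.span K (φ '' U) := by
    obtain ⟨⟨x, hx⟩, hxker⟩ := x
    have hπx : π x = 0 := congrArg Subtype.val hxker
    obtain ⟨u, -, hu⟩ := exists_map_eq_of_mem_gammaLCS φ π.ker (fun x ↦ by
      obtain ⟨u, hu⟩ := hf (π x)
      exact ⟨u, by rw [LieHom.mem_ker, map_sub, hφ, hu, sub_self]⟩) i hx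
    rw [hcent, LieSubmodule.mem_bot, sub_eq_zero] at hu
    subst hu
    have hfu : u ∈ f.ker.toSubmodule := by
      change f u = 0
      rw [← hφ, hπx]
    obtain ⟨s, hs, r, hr, rfl⟩ := Submodule.mem_sup.mp (hle hfu)
    have hr0 : φ r = 0 := by
      have := map_mem_gammaRel φ (S := f.ker) (R := π.ker) (fun x hx ↦ by
        rw [LieHom.mem_ker, hφ]; exact hx) i hr
      rwa [hcent, LieSubmodule.mem_bot] at this
    change φ (s + r) ∈ _
    rw [map_add, hr0, add_zero]
    have := Submodule.mem_map_of_mem (f := (φ : _ →ₗ[K] L)) hs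
    rwa [Submodule.map_span] at this
  let incl : (gammaLCSMap π i).ker.toSubmodule →ₗ[K] L :=
    (gammaLCS K L i).toSubmodule.subtype ∘ₗ (gammaLCSMap π i).ker.toSubmodule.subtype
  refine FiniteDimensional.of_injective (incl.codRestrict (Submodule.span K (φ '' U)) hmem)
    fun x y hxy ↦ ?_
  have hxy' := congrArg Subtype.val hxy
  exact Subtype.ext (Subtype.ext hxy')

theorem lie_eq_zero_of_mem_ker_gammaLCSMap {K L M : Type*} [Field K] [LieRing L] [LieAlgebra K L]
    [LieRing M] [LieAlgebra K M] (π : L →ₗ⁅K⁆ M) (i : ℕ) (hcent : gammaRel K L π.ker i = ⊥)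
    {z : gammaLCS K L i} (hz : z ∈ (gammaLCSMap π i).ker) (x : gammaLCS K L i) : ⁅z, x⁆ = 0 := by
  have hz' : (z : L) ∈ π.ker := congrArg Subtype.val hz
  have h := lie_gammaRel_gammaLCS_le π.ker i 0 (LieSubmodule.lie_mem_lie hz' x.2)
  rw [zero_add] at h
  have h' := gammaRel_succ_le_s12 π.ker i h
  rw [hcent, LieSubmodule.mem_bot] at h'
  exact Subtype.ext h'

theorem gamma_fp_iff_of_icentral_ext (K : Type*) [Field K]
    (M : Type u) [LieRing M] [LieAlgebra K M]
    (hM : LieAlgebraFP K M) (i : ℕ) (hi : 1 ≤ i)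
    (L : Type v) [LieRing L] [LieAlgebra K L] (π : L →ₗ⁅K⁆ M)
    (hsurj : Function.Surjective π) (hcent : gammaRel K L π.ker i = ⊥) :
    LieAlgebraFP K ↑(gammaLCS K L i) ↔ LieAlgebraFP K ↑(gammaLCS K M i) := by
  have hfd := finiteDimensional_ker_gammaLCSMap hM π hsurj i hcent
  have hp := gammaLCSMap_surjective π hsurj i
  constructor
  · intro hL
    obtain ⟨Z, hZ⟩ := (Submodule.fg_iff_finiteDimensional _).mpr hfd
    exact hL.of_surjective_of_finite_ker _ hp Z Z.finite_toSet hZ.symm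
  · exact LieAlgebraFP.of_central_ext _ hp hfd
      fun z hz ↦ lie_eq_zero_of_mem_ker_gammaLCSMap π i hcent hz
end
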